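/- Let Σⁿ ⊂ ℝ^{n+1} be a complete immersed two-sided mean convex self-expander. Fix 1 ≤ k < n and set Σᵏ = {p ∈ Σ : κ_k(p) < κ_{k+1}(p)}. Then the function φ(λ_k/H), which is smooth on Σᵏ, cannot attain a negative infimum at an interior point of Σᵏ. -/

import Mathlib

open scoped RealInnerProductSpace

noncomputable section

/-! Local-coordinate framework for an immersed hypersurface patch `X : ℝⁿ → ℝ^{n+1}`
with unit normal `ν`: induced metric, second fundamental form, mean curvature,
Christoffel symbols, Laplace–Beltrami operator, and the tangential drift term ⟨∇f, xᵀ⟩. -/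

abbrev Euc (n : ℕ) := EuclideanSpace ℝ (Fin n)

/-- `i`-th standard basis vector. -/
def bv (n : ℕ) (i : Fin n) : Euc n := EuclideanSpace.single i 1

/-- Partial derivative of a scalar function. -/
def pd {n : ℕ} (f : Euc n → ℝ) (i : Fin n) (p : Euc n) : ℝ := fderiv ℝ f p (bv n i)

/-- Partial derivative of a vector-valued function. -/
def pdV {n m : ℕ} (X : Euc n → Euc m) (i : Fin n) (p : Euc n) : Euc m := fderiv ℝ X p (bv n i)

/-- Induced metric g_{ij} = ⟨∂_i X, ∂_j X⟩. -/
def gm {n : ℕ} (X : Euc n → Euc (n + 1)) (i j : Fin n) (p : Euc n) : ℝ :=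
  ⟪pdV X i p, pdV X j p⟫

/-- The metric as a matrix. -/
def gMat {n : ℕ} (X : Euc n → Euc (n + 1)) (p : Euc n) : Matrix (Fin n) (Fin n) ℝ :=
  Matrix.of fun i j => gm X i j p

/-- The inverse metric g^{ij}. -/
def gInv {n : ℕ} (X : Euc n → Euc (n + 1)) (p : Euc n) : Matrix (Fin n) (Fin n) ℝ :=
  (gMat X p)⁻¹

/-- Second fundamental form h_{ij} = ⟨∂_i∂_j X, ν⟩. -/
def sff {n : ℕ} (X ν : Euc n → Euc (n + 1)) (i j : Fin n) (p : Euc n) : ℝ :=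
  ⟪pdV (pdV X i) j p, ν p⟫

/-- Mean curvature H = g^{ij} h_{ij}. -/
def meanCurv {n : ℕ} (X ν : Euc n → Euc (n + 1)) (p : Euc n) : ℝ :=
  ∑ i, ∑ j, gInv X p i j * sff X ν i j p

/-- Squared norm of the second fundamental form |A|² = g^{ia} g^{jb} h_{ij} h_{ab}. -/
def normA2 {n : ℕ} (X ν : Euc n → Euc (n + 1)) (p : Euc n) : ℝ :=
  ∑ i, ∑ j, ∑ a, ∑ b, gInv X p i a * gInv X p j b * sff X ν i j p * sff X ν a b p

/-- Christoffel symbols Γ^k_{ij} = ½ g^{kl} (∂_i g_{jl} + ∂_j g_{il} − ∂_l g_{ij}). -/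
def christ {n : ℕ} (X : Euc n → Euc (n + 1)) (k i j : Fin n) (p : Euc n) : ℝ :=
  (1 / 2) * ∑ l, gInv X p k l * (pd (gm X j l) i p + pd (gm X i l) j p - pd (gm X i j) l p)

/-- Laplace–Beltrami operator Δf = g^{ij} (∂_i∂_j f − Γ^a_{ij} ∂_a f). -/
def lapBel {n : ℕ} (X : Euc n → Euc (n + 1)) (f : Euc n → ℝ) (p : Euc n) : ℝ :=
  ∑ i, ∑ j, gInv X p i j * (pd (pd f j) i p - ∑ a, christ X a i j p * pd f a p)

/-- Drift term ⟨∇f, xᵀ⟩ = g^{ij} ∂_j f ⟨∂_i X, X⟩. -/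
def driftTerm {n : ℕ} (X ν : Euc n → Euc (n + 1)) (f : Euc n → ℝ) (p : Euc n) : ℝ :=
  ∑ i, ∑ j, gInv X p i j * pd f j p * ⟪pdV X i p, X p⟫

/-- Covariant derivative of the second fundamental form:
(∇h)_{kij} = ∂_k h_{ij} − Γ^a_{ki} h_{aj} − Γ^a_{kj} h_{ia}. -/
def covDh {n : ℕ} (X ν : Euc n → Euc (n + 1)) (k i j : Fin n) (p : Euc n) : ℝ :=
  pd (sff X ν i j) k p - (∑ a, christ X a k i p * sff X ν a j p)
    - ∑ a, christ X a k j p * sff X ν i a p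

/-- The Spruck–Xiao cutoff function. -/
def phiSX : ℝ → ℝ := fun t => if t < 0 then -t ^ 4 * Real.exp (-1 / t ^ 2) else 0

/-- λ_k = κ₁ + ⋯ + κ_k (0-indexed: the sum of the k smallest principal curvatures). -/
def lamk {n : ℕ} (κ : Euc n → Fin n → ℝ) (k : ℕ) (p : Euc n) : ℝ :=
  ∑ i ∈ Finset.univ.filter (fun i : Fin n => i.val < k), κ p i

/-- The quotient λ_k/H. -/
def ratk {n : ℕ} (X ν : Euc n → Euc (n + 1)) (κ : Euc n → Fin n → ℝ) (k : ℕ) (p : Euc n) : ℝ :=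
  lamk κ k p / meanCurv X ν p

/-- Intrinsic inner product of gradients: ⟨∇f, ∇g⟩ = g^{ij} ∂_i f ∂_j g. -/
def gradSq {n : ℕ} (X : Euc n → Euc (n + 1)) (f g : Euc n → ℝ) (p : Euc n) : ℝ :=
  ∑ i, ∑ j, gInv X p i j * pd f i p * pd g j p

/-- The operator L f = Δf + ⟨∇f, x⟩ + 2⟨∇f, ∇H/H⟩. -/
def Lop {n : ℕ} (X ν : Euc n → Euc (n + 1)) (f : Euc n → ℝ) (p : Euc n) : ℝ :=
  lapBel X f p + driftTerm X ν f p + 2 * gradSq X f (meanCurv X ν) p / meanCurv X ν p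

/-- Number of distinct principal curvatures. -/
def numDistinct {n : ℕ} (κ : Euc n → Fin n → ℝ) (p : Euc n) : ℕ :=
  (Finset.univ.image (κ p)).card

/-- Components of ∇h in the adapted orthonormal eigenframe τ:
∇_{τ_a} h(τ_l, τ_s) = Σ_{b,c,e} (∇h)_{bce} τ_a^b τ_l^c τ_s^e. -/
def frameDh {n : ℕ} (X ν : Euc n → Euc (n + 1)) (τ : Euc n → Fin n → Fin n → ℝ)
    (a l s : Fin n) (p : Euc n) : ℝ :=
  ∑ b, ∑ c, ∑ e, covDh X ν b c e p * τ p a b * τ p l c * τ p s e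

/-- Ky Fan type bound: the sum of the lowest eigenvalues of a symmetric operator is bounded by its
trace against the approximate projection `2S - S²`, `S = ∑ τᵢ ⊗ τᵢ`, `τᵢ = Tᵢ + t ρᵢ`. -/
theorem sum_lowest_eigenvalues_le {E ι ι' : Type*} [NormedAddCommGroup E] [InnerProductSpace ℝ E]
    [Fintype ι] [DecidableEq ι] [DecidableEq ι'] (b : OrthonormalBasis ι ℝ E) (B : E →L[ℝ] E)
    (β : ι → ℝ)
    (hB : ∀ α, B (b α) = β α • b α) {c m : ℝ} (hmc : m ≤ c) (s : Finset ι)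
    (hs : ∀ α ∈ s, β α ≤ m) (hs' : ∀ α ∉ s, m ≤ β α) (J : Finset ι') (hcard : J.card = s.card)
    (T ρ : ι' → E) (hT : ∀ i ∈ J, ∀ j ∈ J, ⟪T i, T j⟫ = if i = j then 1 else 0)
    (hTρ : ∀ i ∈ J, ∀ j ∈ J, ⟪T i, ρ j⟫ = 0) (t : ℝ) (ht : t ^ 2 * ∑ i ∈ J, ‖ρ i‖ ^ 2 ≤ 1) :
    ∑ α ∈ s, β α ≤ ∑ i ∈ J, ⟪B (T i + t • ρ i), T i + t • ρ i⟫
      - t ^ 2 * ∑ i ∈ J, ∑ j ∈ J, ⟪ρ i, ρ j⟫ * ⟪B (T i + t • ρ i), T j + t • ρ j⟫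
      + c * (t ^ 4 * ∑ i ∈ J, ∑ j ∈ J, ⟪ρ i, ρ j⟫ ^ 2) := by
  set τ : ι' → E := fun i => T i + t • ρ i with hτ
  have hG : ∀ i ∈ J, ∀ j ∈ J, ⟪τ i, τ j⟫ = (if i = j then 1 else 0) + t ^ 2 * ⟪ρ i, ρ j⟫ := by
    intro i hi j hj
    have h1 : ⟪ρ i, T j⟫ = 0 := by rw [real_inner_comm]; exact hTρ j hj i hi
    simp only [hτ, inner_add_left, inner_add_right, real_inner_smul_left, real_inner_smul_right,
      hT i hi j hj, hTρ i hi j hj, h1]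
    ring
  set P : ι → ℝ := fun α => ∑ i ∈ J, ⟪τ i, b α⟫ ^ 2
    - t ^ 2 * ∑ i ∈ J, ∑ j ∈ J, ⟪ρ i, ρ j⟫ * (⟪τ i, b α⟫ * ⟪τ j, b α⟫) with hP
  have hPz : ∀ α, P α = 2 * ⟪∑ i ∈ J, ⟪τ i, b α⟫ • τ i, b α⟫
      - ‖∑ i ∈ J, ⟪τ i, b α⟫ • τ i‖ ^ 2 := by
    intro α
    rw [← real_inner_self_eq_norm_sq]
    simp only [sum_inner, inner_sum, real_inner_smul_left, real_inner_smul_right]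
    have : ∑ x ∈ J, ∑ i ∈ J, ⟪τ x, b α⟫ * (⟪τ i, b α⟫ * ⟪τ i, τ x⟫)
        = ∑ i ∈ J, ⟪τ i, b α⟫ ^ 2
          + t ^ 2 * ∑ i ∈ J, ∑ j ∈ J, ⟪ρ i, ρ j⟫ * (⟪τ i, b α⟫ * ⟪τ j, b α⟫) := by
      rw [Finset.mul_sum, ← Finset.sum_add_distrib]
      refine Finset.sum_congr rfl fun x hx => ?_
      have : ∀ i ∈ J, ⟪τ x, b α⟫ * (⟪τ i, b α⟫ * ⟪τ i, τ x⟫)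
          = (if i = x then ⟪τ x, b α⟫ ^ 2 else 0)
            + t ^ 2 * (⟪ρ x, ρ i⟫ * (⟪τ x, b α⟫ * ⟪τ i, b α⟫)) := by
        intro i hi
        rw [hG i hi x hx, real_inner_comm (ρ i) (ρ x)]
        split_ifs with h
        · subst h; ring
        · ring
      rw [Finset.sum_congr rfl this, Finset.sum_add_distrib, Finset.sum_ite_eq' J x]
      simp only [hx, if_true, Finset.mul_sum]
    rw [this]
    simp only [hP, ← pow_two]
    ring
  have hP1 : ∀ α, P α ≤ 1 := by
    intro α
    have h := sq_nonneg ‖b α - ∑ i ∈ J, ⟪τ i, b α⟫ • τ i‖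
    rw [norm_sub_sq_real, b.orthonormal.1 α, real_inner_comm] at h
    rw [hPz]; linarith
  have hP0 : ∀ α, 0 ≤ P α := by
    intro α
    have h1 : ∑ i ∈ J, ∑ j ∈ J, ⟪ρ i, ρ j⟫ * (⟪τ i, b α⟫ * ⟪τ j, b α⟫)
        = ‖∑ i ∈ J, ⟪τ i, b α⟫ • ρ i‖ ^ 2 := by
      rw [← real_inner_self_eq_norm_sq]
      simp only [sum_inner, inner_sum, real_inner_smul_left, real_inner_smul_right]
      refine Finset.sum_congr rfl fun x _ => Finset.sum_congr rfl fun y _ => ?_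
      rw [real_inner_comm]; ring
    have h2 : ‖∑ i ∈ J, ⟪τ i, b α⟫ • ρ i‖ ^ 2
        ≤ (∑ i ∈ J, ⟪τ i, b α⟫ ^ 2) * ∑ i ∈ J, ‖ρ i‖ ^ 2 := by
      have h3 : ‖∑ i ∈ J, ⟪τ i, b α⟫ • ρ i‖ ≤ ∑ i ∈ J, |⟪τ i, b α⟫| * ‖ρ i‖ := by
        refine (norm_sum_le _ _).trans (le_of_eq ?_)
        simp [norm_smul]
      calc _ ≤ (∑ i ∈ J, |⟪τ i, b α⟫| * ‖ρ i‖) ^ 2 := by gcongr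
        _ ≤ _ := by
          refine (Finset.sum_mul_sq_le_sq_mul_sq _ _ _).trans (le_of_eq ?_)
          simp
    have h4 : 0 ≤ ∑ i ∈ J, ⟪τ i, b α⟫ ^ 2 := Finset.sum_nonneg fun _ _ => sq_nonneg _
    simp only [hP, h1]
    nlinarith [mul_le_mul_of_nonneg_left h2 (sq_nonneg t), mul_le_mul_of_nonneg_left ht h4]
  have hpars : ∀ x y : E, ∑ α, ⟪x, b α⟫ * ⟪y, b α⟫ = ⟪x, y⟫ := by
    intro x y
    rw [← b.sum_inner_mul_inner x y]
    exact Finset.sum_congr rfl fun α _ => by rw [real_inner_comm y]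
  have hparsB : ∀ x y : E, ∑ α, β α * (⟪x, b α⟫ * ⟪y, b α⟫) = ⟪B x, y⟫ := by
    intro x y
    conv_rhs => rw [← b.sum_repr' x]
    simp only [map_sum, map_smul, hB, sum_inner, real_inner_smul_left]
    refine Finset.sum_congr rfl fun α _ => ?_
    rw [real_inner_comm x, real_inner_comm y]; ring
  have hsumP : ∑ α, P α = J.card - t ^ 4 * ∑ i ∈ J, ∑ j ∈ J, ⟪ρ i, ρ j⟫ ^ 2 := by
    have e1 : ∑ α, P α = ∑ i ∈ J, ⟪τ i, τ i⟫
        - t ^ 2 * ∑ i ∈ J, ∑ j ∈ J, ⟪ρ i, ρ j⟫ * ⟪τ i, τ j⟫ := by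
      simp only [hP, Finset.sum_sub_distrib, ← Finset.mul_sum]
      congr 1
      · rw [Finset.sum_comm]
        exact Finset.sum_congr rfl fun i _ => by simp only [pow_two]; exact hpars _ _
      · congr 1
        rw [Finset.sum_comm]
        refine Finset.sum_congr rfl fun i _ => ?_
        rw [Finset.sum_comm]
        exact Finset.sum_congr rfl fun j _ => by rw [← Finset.mul_sum, hpars]
    have e2 : ∀ i ∈ J, ∑ j ∈ J, ⟪ρ i, ρ j⟫ * ⟪τ i, τ j⟫
        = ⟪ρ i, ρ i⟫ + t ^ 2 * ∑ j ∈ J, ⟪ρ i, ρ j⟫ ^ 2 := by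
      intro i hi
      rw [Finset.mul_sum]
      have : ∀ j ∈ J, ⟪ρ i, ρ j⟫ * ⟪τ i, τ j⟫
          = (if i = j then ⟪ρ i, ρ j⟫ else 0) + t ^ 2 * ⟪ρ i, ρ j⟫ ^ 2 := by
        intro j hj
        rw [hG i hi j hj]; split_ifs <;> ring
      rw [Finset.sum_congr rfl this, Finset.sum_add_distrib, Finset.sum_ite_eq J i, if_pos hi]
    have e3 : ∀ i ∈ J, ⟪τ i, τ i⟫ = 1 + t ^ 2 * ⟪ρ i, ρ i⟫ := fun i hi => by
      rw [hG i hi i hi, if_pos rfl]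
    rw [e1, Finset.sum_congr rfl e2, Finset.sum_congr rfl e3, Finset.sum_add_distrib,
      Finset.sum_add_distrib, ← Finset.mul_sum, ← Finset.mul_sum]
    simp only [Finset.sum_const, nsmul_eq_mul, mul_one]
    ring
  have hsumβP : ∑ α, β α * P α = ∑ i ∈ J, ⟪B (τ i), τ i⟫
      - t ^ 2 * ∑ i ∈ J, ∑ j ∈ J, ⟪ρ i, ρ j⟫ * ⟪B (τ i), τ j⟫ := by
    have e : ∀ α, β α * P α = ∑ i ∈ J, β α * (⟪τ i, b α⟫ * ⟪τ i, b α⟫)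
        - t ^ 2 * ∑ i ∈ J, ∑ j ∈ J, ⟪ρ i, ρ j⟫ * (β α * (⟪τ i, b α⟫ * ⟪τ j, b α⟫)) := by
      intro α
      simp only [hP, mul_sub, Finset.mul_sum]
      congr 1
      · exact Finset.sum_congr rfl fun i _ => by ring
      · exact Finset.sum_congr rfl fun i _ => Finset.sum_congr rfl fun j _ => by ring
    simp only [e, Finset.sum_sub_distrib]
    congr 1
    · rw [Finset.sum_comm]
      exact Finset.sum_congr rfl fun i _ => hparsB _ _
    · rw [← Finset.mul_sum]
      congr 1
      rw [Finset.sum_comm]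
      refine Finset.sum_congr rfl fun i _ => ?_
      rw [Finset.sum_comm]
      exact Finset.sum_congr rfl fun j _ => by rw [← Finset.mul_sum, hparsB]
  have hmain : ∑ α ∈ s, (β α - c) ≤ ∑ α, P α * (β α - c) := by
    rw [← Finset.sum_add_sum_compl s (fun α => P α * (β α - c))]
    have h1 : ∑ α ∈ s, (1 - P α) * (β α - c) ≤ ∑ α ∈ s, (1 - P α) * (m - c) :=
      Finset.sum_le_sum fun α hα =>
        mul_le_mul_of_nonneg_left (by linarith [hs α hα]) (by linarith [hP1 α])
    have h2 : ∑ α ∈ sᶜ, P α * (m - c) ≤ ∑ α ∈ sᶜ, P α * (β α - c) :=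
      Finset.sum_le_sum fun α hα =>
        mul_le_mul_of_nonneg_left (by linarith [hs' α (Finset.mem_compl.1 hα)]) (hP0 α)
    rw [← Finset.sum_mul] at h1 h2
    have h3 : ∑ α ∈ s, (1 - P α) = s.card - ∑ α ∈ s, P α := by simp
    have h4 := Finset.sum_add_sum_compl s P
    have h5 : 0 ≤ t ^ 4 * ∑ i ∈ J, ∑ j ∈ J, ⟪ρ i, ρ j⟫ ^ 2 := by positivity
    have h6 : ∑ α ∈ sᶜ, P α ≤ ∑ α ∈ s, (1 - P α) := by
      rw [h3, ← hcard]; linarith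
    have h7 := mul_le_mul_of_nonpos_right h6 (by linarith : m - c ≤ 0)
    have h8 : ∑ α ∈ s, (1 - P α) * (β α - c)
        = ∑ α ∈ s, (β α - c) - ∑ α ∈ s, P α * (β α - c) := by
      rw [← Finset.sum_sub_distrib]
      exact Finset.sum_congr rfl fun α _ => by ring
    linarith
  have h9 : ∑ α, P α * (β α - c) = ∑ α, β α * P α - c * ∑ α, P α := by
    rw [Finset.mul_sum, ← Finset.sum_sub_distrib]
    exact Finset.sum_congr rfl fun α _ => by ring
  rw [Finset.sum_sub_distrib, h9, hsumβP, hsumP, hcard] at hmain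
  simp only [Finset.sum_const, nsmul_eq_mul] at hmain
  linarith

/-- Second derivative test at a local minimum for `t ↦ A t + t D t + t² G t`. -/
theorem second_order_of_isLocalMin {A A' D D' G G' : ℝ → ℝ} {a₂ d₂ g₂ : ℝ}
    (hA : ∀ᶠ t in nhds (0 : ℝ), HasDerivAt A (A' t) t) (hA' : HasDerivAt A' a₂ 0)
    (hD : ∀ᶠ t in nhds (0 : ℝ), HasDerivAt D (D' t) t) (hD' : HasDerivAt D' d₂ 0)
    (hG : ∀ᶠ t in nhds (0 : ℝ), HasDerivAt G (G' t) t) (hG' : HasDerivAt G' g₂ 0)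
    (hmin : IsLocalMin (fun t => A t + t * D t + t ^ 2 * G t) 0) :
    A' 0 + D 0 = 0 ∧ 0 ≤ a₂ + 2 * D' 0 + 2 * G 0 := by
  set F : ℝ → ℝ := fun t => A t + t * D t + t ^ 2 * G t with hF
  set F' : ℝ → ℝ := fun t => A' t + (1 * D t + t * D' t) + ((2 : ℕ) * t ^ (2 - 1) * G t + t ^ 2 * G' t)
  have h1 : ∀ᶠ t in nhds (0 : ℝ), HasDerivAt F (F' t) t := by
    filter_upwards [hA, hD, hG] with t h1 h2 h3
    exact (h1.add ((hasDerivAt_id t).mul h2)).add ((hasDerivAt_pow 2 t).mul h3)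
  have h0 : F' 0 = 0 := hmin.hasDerivAt_eq_zero h1.self_of_nhds
  have h2 : HasDerivAt F' (a₂ + 2 * D' 0 + 2 * G 0) 0 := by
    have hD0 := hD.self_of_nhds
    have hG0 := hG.self_of_nhds
    have := (hA'.add ((hD0.const_mul 1).add ((hasDerivAt_id (0 : ℝ)).mul hD'))).add
      ((((hasDerivAt_pow (2 - 1) (0 : ℝ)).const_mul ((2 : ℕ) : ℝ)).mul hG0).add
        ((hasDerivAt_pow 2 (0 : ℝ)).mul hG'))
    refine this.congr_deriv ?_
    simp
    ring
  refine ⟨by simpa [F'] using h0, ?_⟩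
  by_contra! hneg
  have hd : deriv F =ᶠ[nhds 0] F' := h1.mono fun t ht => ht.deriv
  have hdd : deriv (deriv F) 0 = a₂ + 2 * D' 0 + 2 * G 0 := by
    rw [hd.deriv_eq]; exact h2.deriv
  have hmax : IsLocalMax F 0 := isLocalMax_of_deriv_deriv_neg (by rw [hdd]; exact hneg)
    (by rw [hd.self_of_nhds]; exact h0) h1.self_of_nhds.continuousAt
  have hconst : F =ᶠ[nhds 0] fun _ => F 0 := by
    filter_upwards [hmin, hmax] with t h1 h2
    exact le_antisymm h2 h1
  have h3 : deriv F =ᶠ[nhds 0] fun _ => 0 := by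
    simpa using hconst.deriv
  have h4 : deriv (deriv F) 0 = 0 := by rw [h3.deriv_eq]; simp
  linarith

/-- Simultaneous diagonalization of a positive definite form `g` and a symmetric form `h`,
with prescribed ordering of the eigenvalues of `g⁻¹ h`. -/
theorem exists_simultaneous_diagonalization {n : ℕ} (g h : Matrix (Fin n) (Fin n) ℝ)
    (hg : g.PosDef) (hh : h.IsSymm) (κ : Fin n → ℝ)
    (hκm : Monotone κ)
    (hκ : (g⁻¹ * h).charpoly = ∏ i, (Polynomial.X - Polynomial.C (κ i))) :
    ∃ D : Matrix (Fin n) (Fin n) ℝ, D.transpose * g * D = 1 ∧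
      D.transpose * h * D = Matrix.diagonal κ := by
  have hdiag : ∀ {M : Matrix (Fin n) (Fin n) ℝ} (hM : M.IsHermitian),
      (hM.eigenvectorUnitary : Matrix (Fin n) (Fin n) ℝ).transpose * M * hM.eigenvectorUnitary
        = Matrix.diagonal hM.eigenvalues := by
    intro M hM
    have := hM.conjStarAlgAut_star_eigenvectorUnitary
    rw [Unitary.conjStarAlgAut_star_apply] at this
    simpa [Matrix.star_eq_conjTranspose, Matrix.conjTranspose_eq_transpose_of_trivial,
      Function.comp_def] using this
  have horth : ∀ {M : Matrix (Fin n) (Fin n) ℝ} (hM : M.IsHermitian),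
      (hM.eigenvectorUnitary : Matrix (Fin n) (Fin n) ℝ).transpose * hM.eigenvectorUnitary
        = 1 := by
    intro M hM
    have := Unitary.coe_star_mul_self hM.eigenvectorUnitary
    simpa [Matrix.star_eq_conjTranspose, Matrix.conjTranspose_eq_transpose_of_trivial] using this
  obtain ⟨Ψ, hΨ⟩ : ∃ Ψ : Matrix (Fin n) (Fin n) ℝ, Ψ.transpose * g * Ψ = 1 := by
    set U : Matrix (Fin n) (Fin n) ℝ := ((hg.1.eigenvectorUnitary : Matrix.unitaryGroup (Fin n) ℝ) :
      Matrix (Fin n) (Fin n) ℝ)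
    refine ⟨U * Matrix.diagonal fun i => (√(hg.1.eigenvalues i))⁻¹, ?_⟩
    have e : (U * Matrix.diagonal fun i => (√(hg.1.eigenvalues i))⁻¹).transpose * g
        * (U * Matrix.diagonal fun i => (√(hg.1.eigenvalues i))⁻¹)
        = Matrix.diagonal (fun i => (√(hg.1.eigenvalues i))⁻¹) * (U.transpose * g * U)
          * Matrix.diagonal fun i => (√(hg.1.eigenvalues i))⁻¹ := by
      simp only [Matrix.transpose_mul, Matrix.diagonal_transpose, Matrix.mul_assoc]
    rw [e, hdiag hg.1, Matrix.diagonal_mul_diagonal, Matrix.diagonal_mul_diagonal,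
      ← Matrix.diagonal_one]
    congr 1
    ext i
    have hpos := hg.eigenvalues_pos i
    have hs := Real.mul_self_sqrt hpos.le
    have hs' : √(hg.1.eigenvalues i) ≠ 0 := (Real.sqrt_pos.2 hpos).ne'
    field_simp
    rw [pow_two, hs]
  have hginv : g⁻¹ = Ψ * Ψ.transpose := by
    have h1 : Ψ * (Ψ.transpose * g) = 1 := mul_eq_one_comm.1 hΨ
    exact Matrix.inv_eq_left_inv (by rw [Matrix.mul_assoc, h1])
  have hM : (Ψ.transpose * h * Ψ).IsHermitian := by
    rw [Matrix.IsHermitian, Matrix.conjTranspose_eq_transpose_of_trivial]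
    simp only [Matrix.transpose_mul, Matrix.transpose_transpose, hh.eq, Matrix.mul_assoc]
  set V : Matrix (Fin n) (Fin n) ℝ := ((hM.eigenvectorUnitary : Matrix.unitaryGroup (Fin n) ℝ) :
    Matrix (Fin n) (Fin n) ℝ)
  have hchar : ∏ i, (Polynomial.X - Polynomial.C (κ i))
      = ∏ i, (Polynomial.X - Polynomial.C (hM.eigenvalues i)) := by
    rw [← hκ, hginv, Matrix.mul_assoc, Matrix.charpoly_mul_comm]
    exact hM.charpoly_eq
  have hms : Multiset.map κ Finset.univ.val = Multiset.map hM.eigenvalues Finset.univ.val := by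
    have := congrArg Polynomial.roots hchar
    rw [Polynomial.roots_prod _ _ (Finset.prod_ne_zero_iff.2 fun i _ =>
      Polynomial.X_sub_C_ne_zero _), Polynomial.roots_prod _ _ (Finset.prod_ne_zero_iff.2
      fun i _ => Polynomial.X_sub_C_ne_zero _)] at this
    simpa using this
  obtain ⟨σ, hσ⟩ : ∃ σ : Equiv.Perm (Fin n), hM.eigenvalues ∘ σ = κ := by
    refine ⟨Tuple.sort hM.eigenvalues, ?_⟩
    have hperm : (List.ofFn (hM.eigenvalues ∘ Tuple.sort hM.eigenvalues)).Perm (List.ofFn κ) := by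
      refine ((Tuple.sort hM.eigenvalues).ofFn_comp_perm hM.eigenvalues).trans ?_
      rw [← Multiset.coe_eq_coe]
      simpa [Fin.univ_val_map] using hms.symm
    exact List.ofFn_injective (hperm.eq_of_pairwise' 
      (Tuple.monotone_sort hM.eigenvalues).sortedLE_ofFn.pairwise hκm.sortedLE_ofFn.pairwise)
  have hD1 : (Ψ * V).transpose * g * (Ψ * V) = 1 := by
    have : (Ψ * V).transpose * g * (Ψ * V) = V.transpose * (Ψ.transpose * g * Ψ) * V := by
      simp only [Matrix.transpose_mul, Matrix.mul_assoc]
    rw [this, hΨ, Matrix.mul_one, horth hM]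
  have hD2 : (Ψ * V).transpose * h * (Ψ * V) = Matrix.diagonal hM.eigenvalues := by
    have : (Ψ * V).transpose * h * (Ψ * V) = V.transpose * (Ψ.transpose * h * Ψ) * V := by
      simp only [Matrix.transpose_mul, Matrix.mul_assoc]
    rw [this, hdiag hM]
  have hsub : ∀ N : Matrix (Fin n) (Fin n) ℝ, ((Ψ * V).submatrix id σ).transpose * N *
      (Ψ * V).submatrix id σ = ((Ψ * V).transpose * N * (Ψ * V)).submatrix σ σ := by
    intro N
    ext i j
    simp only [Matrix.mul_apply, Matrix.submatrix_apply, Matrix.transpose_apply, id]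
  refine ⟨(Ψ * V).submatrix id σ, ?_, ?_⟩
  · rw [hsub, hD1]; simp
  · rw [hsub, hD2, ← hσ]; simp

/-- An orthonormal `n`-tuple and a unit normal in `ℝⁿ⁺¹` form an orthonormal basis. -/
theorem exists_orthonormalBasis_option {n : ℕ} {T : Fin n → Euc (n + 1)} {N : Euc (n + 1)}
    (hT : ∀ a b, ⟪T a, T b⟫ = if a = b then (1 : ℝ) else 0) (hN : ‖N‖ = 1)
    (hTN : ∀ a, ⟪T a, N⟫ = (0 : ℝ)) :
    ∃ b : OrthonormalBasis (Option (Fin n)) ℝ (Euc (n + 1)),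
      b none = N ∧ ∀ a, b (some a) = T a := by
  have hv : Orthonormal ℝ (fun o : Option (Fin n) => o.elim N T) := by
    rw [orthonormal_iff_ite]
    rintro (_ | a) (_ | b)
    · simp [hN]
    · simpa [real_inner_comm] using hTN b
    · simpa using hTN a
    · simpa using hT a b
  have hcard : Fintype.card (Option (Fin n)) = Module.finrank ℝ (Euc (n + 1)) := by simp
  have hspan : Submodule.span ℝ (Set.range fun o : Option (Fin n) => o.elim N T) = ⊤ :=
    hv.linearIndependent.span_eq_top_of_card_eq_finrank' hcard
  refine ⟨OrthonormalBasis.mk hv hspan.ge, ?_, fun a => ?_⟩ <;> simp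

/-- A hypersurface patch `X` with unit normal `ν` and support function `⟪X, ν⟫` equal to the
sum of the principal curvatures `κ`, the latter diagonalizing the shape operator on `Ω`. -/
structure IsExpanderPatch {n : ℕ} (X ν : Euc n → Euc (n + 1)) (Ω : Set (Euc n))
    (κ : Euc n → Fin n → ℝ) : Prop where
  isOpen : IsOpen Ω
  contDiff : ContDiff ℝ (⊤ : ℕ∞) X
  contDiff_normal : ContDiff ℝ (⊤ : ℕ∞) ν
  norm_normal : ∀ p ∈ Ω, ‖ν p‖ = 1
  inner_normal : ∀ p ∈ Ω, ∀ u, ⟪fderiv ℝ X p u, ν p⟫ = (0 : ℝ)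
  frame : ∀ p ∈ Ω, ∃ d : Fin n → Euc n,
    (∀ a b, ⟪fderiv ℝ X p (d a), fderiv ℝ X p (d b)⟫ = if a = b then (1 : ℝ) else 0) ∧
    ∀ a, fderiv ℝ ν p (d a) = -κ p a • fderiv ℝ X p (d a)
  sum_curv : ∀ p ∈ Ω, ∑ a, κ p a = ⟪X p, ν p⟫

theorem eq_sum_smul_bv {n : ℕ} (u : Euc n) : u = ∑ i, u i • bv n i := by
  ext j
  simp [bv, Pi.single_apply]

theorem pdV_pdV {n m : ℕ} {X : Euc n → Euc m} (hX : ContDiff ℝ (⊤ : ℕ∞) X) (i j : Fin n)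
    (p : Euc n) : pdV (pdV X i) j p = fderiv ℝ (fderiv ℝ X) p (bv n j) (bv n i) := by
  have h : DifferentiableAt ℝ (fderiv ℝ X) p :=
    ((hX.fderiv_right (m := 1) (by norm_cast)).differentiable (by simp)).differentiableAt
  have : pdV X i = fun q => fderiv ℝ X q (bv n i) := rfl
  rw [this, pdV, fderiv_clm_apply h (differentiableAt_const _)]
  simp

theorem fderiv_fderiv_comm {n m : ℕ} {X : Euc n → Euc m} (hX : ContDiff ℝ (⊤ : ℕ∞) X)
    (p u w : Euc n) : fderiv ℝ (fderiv ℝ X) p u w = fderiv ℝ (fderiv ℝ X) p w u :=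
  (hX.contDiffAt.isSymmSndFDerivAt (by simp; norm_cast)).eq u w

theorem posDef_gMat {n : ℕ} {X : Euc n → Euc (n + 1)} {p : Euc n} (h : IsUnit (gMat X p).det) :
    (gMat X p).PosDef := by
  have h1 : gMat X p = Matrix.gram ℝ (fun i => pdV X i p) := by
    ext i j; simp [gMat, gm, Matrix.gram]
  have h2 : (gMat X p).PosSemidef := h1 ▸ Matrix.posSemidef_gram ℝ _
  exact h2.posDef_iff_isUnit.2 ((Matrix.isUnit_iff_isUnit_det _).2 h)

theorem isExpanderPatch {n : ℕ} {X ν : Euc n → Euc (n + 1)} {Ω : Set (Euc n)} (hΩ : IsOpen Ω)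
    (hX : ContDiff ℝ (⊤ : ℕ∞) X) (hν : ContDiff ℝ (⊤ : ℕ∞) ν)
    (himm : ∀ p ∈ Ω, IsUnit (gMat X p).det)
    (hunit : ∀ p ∈ Ω, ‖ν p‖ = 1)
    (horth : ∀ p ∈ Ω, ∀ i, ⟪ν p, pdV X i p⟫ = (0 : ℝ))
    (hexp : ∀ p ∈ Ω, meanCurv X ν p = ⟪X p, ν p⟫)
    {κ : Euc n → Fin n → ℝ} (hκmono : ∀ p, Monotone (κ p))
    (hκeig : ∀ p ∈ Ω,
      (gInv X p * Matrix.of (fun i j => sff X ν i j p)).charpoly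
        = ∏ i, (Polynomial.X - Polynomial.C (κ p i))) :
    IsExpanderPatch X ν Ω κ := by
  have hXd : ∀ p, DifferentiableAt ℝ (fderiv ℝ X) p := fun p =>
    ((hX.fderiv_right (m := 1) (by norm_cast)).differentiable (by simp)).differentiableAt
  have hνd : ∀ p, DifferentiableAt ℝ ν p := fun p => (hν.differentiable (by simp)).differentiableAt
  have hdecomp : ∀ p u, fderiv ℝ X p u = ∑ i, u i • pdV X i p := by
    intro p u
    conv_lhs => rw [eq_sum_smul_bv u]
    simp [pdV]
  have hinner : ∀ p ∈ Ω, ∀ u, ⟪fderiv ℝ X p u, ν p⟫ = (0 : ℝ) := by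
    intro p hp u
    rw [hdecomp, sum_inner]
    refine Finset.sum_eq_zero fun i _ => ?_
    rw [real_inner_smul_left, real_inner_comm, horth p hp i, mul_zero]
  have hsff : ∀ p ∈ Ω, ∀ i j, ⟪pdV X i p, fderiv ℝ ν p (bv n j)⟫ = -sff X ν i j p := by
    intro p hp i j
    have h0 : (fun q => ⟪fderiv ℝ X q (bv n i), ν q⟫) =ᶠ[nhds p] fun _ => (0 : ℝ) :=
      Filter.Eventually.mono (hΩ.mem_nhds hp) fun q hq => hinner q hq _
    have h1 := (((hXd p).hasFDerivAt.clm_apply (hasFDerivAt_const (bv n i) p)).inner ℝ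
      (hνd p).hasFDerivAt).fderiv
    rw [h0.fderiv_eq] at h1
    have h2 := congrArg (fun L : Euc n →L[ℝ] ℝ => L (bv n j)) h1
    simp [fderivInnerCLM_apply] at h2
    rw [sff, pdV_pdV hX]
    simp only [pdV]
    linarith
  have hsymm : ∀ p, (Matrix.of (fun i j => sff X ν i j p)).IsSymm := by
    intro p
    ext i j
    simp only [Matrix.transpose_apply, Matrix.of_apply, sff, pdV_pdV hX]
    rw [fderiv_fderiv_comm hX]
  have key : ∀ p ∈ Ω, ∃ D : Matrix (Fin n) (Fin n) ℝ, D.transpose * gMat X p * D = 1 ∧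
      D.transpose * Matrix.of (fun i j => sff X ν i j p) * D = Matrix.diagonal (κ p) :=
    fun p hp => exists_simultaneous_diagonalization _ _ (posDef_gMat (himm p hp)) (hsymm p) _
      (hκmono p) (hκeig p hp)
  refine ⟨hΩ, hX, hν, hunit, hinner, fun p hp => ?_, fun p hp => ?_⟩
  · obtain ⟨D, hD1, hD2⟩ := key p hp
    refine ⟨fun a => WithLp.toLp 2 fun i => D i a, ?_⟩
    have hT : ∀ a b, ⟪fderiv ℝ X p (WithLp.toLp 2 fun i => D i a),
        fderiv ℝ X p (WithLp.toLp 2 fun i => D i b)⟫ = if a = b then (1 : ℝ) else 0 := by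
      intro a b
      have := congrFun (congrFun hD1 a) b
      rw [Matrix.one_apply] at this
      rw [← this, hdecomp, hdecomp]
      simp only [Matrix.mul_apply, Matrix.transpose_apply, sum_inner, inner_sum,
        real_inner_smul_left, real_inner_smul_right, gMat, gm, Matrix.of_apply, Finset.sum_mul]
      exact Finset.sum_congr rfl fun i _ => Finset.sum_congr rfl fun j _ => by
        rw [real_inner_comm]; ring
    refine ⟨hT, fun a => ?_⟩
    obtain ⟨b, hb0, hb⟩ := exists_orthonormalBasis_option hT (hunit p hp)
      (fun a => hinner p hp _)
    refine InnerProductSpace.ext_inner_left_basis b.toBasis fun o => ?_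
    simp only [OrthonormalBasis.coe_toBasis]
    cases o with
    | none =>
      rw [hb0, real_inner_smul_right, real_inner_comm (fderiv ℝ X p _), hinner p hp, mul_zero]
      have h0 : (fun q => ⟪ν q, ν q⟫) =ᶠ[nhds p] fun _ => (1 : ℝ) :=
        Filter.Eventually.mono (hΩ.mem_nhds hp) fun q hq => by
          simp [hunit q hq]
      have h1 := ((hνd p).hasFDerivAt.inner ℝ (hνd p).hasFDerivAt).fderiv
      rw [h0.fderiv_eq] at h1
      have h2 := congrArg (fun L : Euc n →L[ℝ] ℝ => L (WithLp.toLp 2 fun i => D i a)) h1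
      simp [fderivInnerCLM_apply] at h2
      linarith [real_inner_comm (ν p) (fderiv ℝ ν p (WithLp.toLp 2 fun i => D i a))]
    | some c =>
      rw [hb, real_inner_smul_right, hT]
      have h2 := congrFun (congrFun hD2 c) a
      rw [Matrix.diagonal_apply] at h2
      have hν' : fderiv ℝ ν p (WithLp.toLp 2 fun i => D i a)
          = ∑ j, D j a • fderiv ℝ ν p (bv n j) := by
        conv_lhs => rw [eq_sum_smul_bv (WithLp.toLp 2 fun i => D i a)]
        simp
      have h3 : ⟪fderiv ℝ X p (WithLp.toLp 2 fun i => D i c),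
          fderiv ℝ ν p (WithLp.toLp 2 fun i => D i a)⟫
          = -(D.transpose * Matrix.of (fun i j => sff X ν i j p) * D) c a := by
        rw [hν', hdecomp]
        simp only [Matrix.mul_apply, Matrix.transpose_apply, sum_inner, inner_sum,
          real_inner_smul_left, real_inner_smul_right, Matrix.of_apply, Finset.sum_mul,
          ← Finset.sum_neg_distrib, hsff p hp]
        exact Finset.sum_congr rfl fun i _ => Finset.sum_congr rfl fun j _ => by ring
      rw [h3, h2]
      split_ifs with h
      · subst h; ring
      · ring
  · obtain ⟨D, hD1, hD2⟩ := key p hp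
    have hginv : (gMat X p)⁻¹ = D * D.transpose := by
      have h1 : D * (D.transpose * gMat X p) = 1 := mul_eq_one_comm.1 hD1
      exact Matrix.inv_eq_left_inv (by rw [Matrix.mul_assoc, h1])
    rw [← hexp p hp, ← Matrix.trace_diagonal, ← hD2, Matrix.mul_assoc, Matrix.trace_mul_comm,
      Matrix.mul_assoc, ← hginv, Matrix.trace_mul_comm, meanCurv, gInv]
    simp only [Matrix.trace, Matrix.diag, Matrix.mul_apply, Matrix.of_apply]
    exact Finset.sum_congr rfl fun i _ => Finset.sum_congr rfl fun j _ => by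
      have := (hsymm p).apply i j
      simp only [Matrix.of_apply] at this
      rw [this]

/-- A smooth field `B` of operators extending the shape operator by `c` on the normal. -/
structure IsShapeField {n : ℕ} (X ν : Euc n → Euc (n + 1)) (Ω : Set (Euc n)) (c : ℝ)
    (B : Euc n → Euc (n + 1) →L[ℝ] Euc (n + 1)) : Prop where
  contDiffAt : ∀ p ∈ Ω, ContDiffAt ℝ (⊤ : ℕ∞) B p
  apply_tangent : ∀ p ∈ Ω, ∀ u, B p (fderiv ℝ X p u) = -fderiv ℝ ν p u
  apply_normal : ∀ p ∈ Ω, B p (ν p) = c • ν p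

/-- The shape operator extended to the ambient space by `c` in the normal direction. -/
theorem IsExpanderPatch.exists_operator {n : ℕ} {X ν : Euc n → Euc (n + 1)} {Ω : Set (Euc n)}
    {κ : Euc n → Fin n → ℝ} (h : IsExpanderPatch X ν Ω κ) (c : ℝ) :
    ∃ B : Euc n → Euc (n + 1) →L[ℝ] Euc (n + 1), IsShapeField X ν Ω c B := by
  set L : Euc n → (Euc n × ℝ) →L[ℝ] Euc (n + 1) := fun p =>
    (fderiv ℝ X p).comp (ContinuousLinearMap.fst ℝ (Euc n) ℝ)
      + (ContinuousLinearMap.snd ℝ (Euc n) ℝ).smulRight (ν p) with hL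
  set K : Euc n → (Euc n × ℝ) →L[ℝ] Euc (n + 1) := fun p =>
    -(fderiv ℝ ν p).comp (ContinuousLinearMap.fst ℝ (Euc n) ℝ)
      + c • (ContinuousLinearMap.snd ℝ (Euc n) ℝ).smulRight (ν p) with hK
  have hX' : ContDiff ℝ (⊤ : ℕ∞) (fderiv ℝ X) := h.contDiff.fderiv_right (by simp)
  have hν' : ContDiff ℝ (⊤ : ℕ∞) (fderiv ℝ ν) := h.contDiff_normal.fderiv_right (by simp)
  have hsr : ContDiff ℝ (⊤ : ℕ∞)
      fun p => (ContinuousLinearMap.snd ℝ (Euc n) ℝ).smulRight (ν p) :=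
    contDiff_const.smulRight h.contDiff_normal
  have hLc : ContDiff ℝ (⊤ : ℕ∞) L := (hX'.clm_comp contDiff_const).add hsr
  have hKc : ContDiff ℝ (⊤ : ℕ∞) K :=
    ((hν'.clm_comp contDiff_const).neg).add (hsr.const_smul c)
  have hLe : ∀ p ∈ Ω, ∃ e : (Euc n × ℝ) ≃L[ℝ] Euc (n + 1), (e : _ →L[ℝ] _) = L p := by
    intro p hp
    obtain ⟨d, hd, -⟩ := h.frame p hp
    obtain ⟨b, hb0, hb⟩ := exists_orthonormalBasis_option hd (h.norm_normal p hp)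
      (fun a => h.inner_normal p hp _)
    have hsurj : Function.Surjective (L p : (Euc n × ℝ) →ₗ[ℝ] Euc (n + 1)) := by
      rw [← LinearMap.range_eq_top, eq_top_iff, ← b.toBasis.span_eq, Submodule.span_le]
      rintro _ ⟨o, rfl⟩
      cases o with
      | none => exact ⟨(0, 1), by simp [hL, hb0]⟩
      | some a => exact ⟨(d a, 0), by simp [hL, hb]⟩
    have hrank : Module.finrank ℝ (Euc n × ℝ) = Module.finrank ℝ (Euc (n + 1)) := by simp
    have hinj := (LinearMap.injective_iff_surjective_of_finrank_eq_finrank hrank).2 hsurj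
    refine ⟨(LinearEquiv.ofBijective _ ⟨hinj, hsurj⟩).toContinuousLinearEquiv, ?_⟩
    ext x <;> rfl
  have hinv : ∀ p ∈ Ω, ∀ x, (L p).inverse (L p x) = x := by
    intro p hp x
    obtain ⟨e, he⟩ := hLe p hp
    rw [← he, ContinuousLinearMap.inverse_equiv]
    simp
  refine ⟨fun p => (K p).comp (L p).inverse, fun p hp => ?_, fun p hp u => ?_, fun p hp => ?_⟩
  · obtain ⟨e, he⟩ := hLe p hp
    exact hKc.contDiffAt.clm_comp (ContDiffAt.comp (g := ContinuousLinearMap.inverse) p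
      (he ▸ contDiffAt_map_inverse e) hLc.contDiffAt)
  · have : fderiv ℝ X p u = L p (u, 0) := by simp [hL]
    rw [this, ContinuousLinearMap.comp_apply, hinv p hp]
    simp [hK]
  · have : ν p = L p (0, 1) := by simp [hL]
    conv_lhs => rw [this, ContinuousLinearMap.comp_apply, hinv p hp]
    simp [hK]

/-- Derivatives of eventually equal functions agree. -/
theorem HasFDerivAt.eq_of_eventuallyEq {E F : Type*} [NormedAddCommGroup E] [NormedSpace ℝ E]
    [NormedAddCommGroup F] [NormedSpace ℝ F] {f g : E → F} {f' g' : E →L[ℝ] F} {q : E}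
    (hf : HasFDerivAt f f' q) (hg : HasFDerivAt g g' q) (hfg : ∀ᶠ p in nhds q, f p = g p)
    (z : E) : f' z = g' z := by
  rw [hf.unique (hg.congr_of_eventuallyEq hfg)]

section ShapeField

variable {n : ℕ} {X ν : Euc n → Euc (n + 1)} {Ω : Set (Euc n)} {κ : Euc n → Fin n → ℝ} {c : ℝ}
  {B : Euc n → Euc (n + 1) →L[ℝ] Euc (n + 1)}

theorem ContDiff.hasFDerivAt_fderiv {E F : Type*} [NormedAddCommGroup E] [NormedSpace ℝ E]
    [NormedAddCommGroup F] [NormedSpace ℝ F] {f : E → F} (hf : ContDiff ℝ (⊤ : ℕ∞) f) (p : E) :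
    HasFDerivAt (fderiv ℝ f) (fderiv ℝ (fderiv ℝ f) p) p :=
  ((hf.fderiv_right (m := 1) (by norm_cast)).differentiable (by simp)).differentiableAt.hasFDerivAt

theorem ContDiff.hasFDerivAt_self {E F : Type*} [NormedAddCommGroup E] [NormedSpace ℝ E]
    [NormedAddCommGroup F] [NormedSpace ℝ F] {f : E → F} (hf : ContDiff ℝ (⊤ : ℕ∞) f) (p : E) :
    HasFDerivAt f (fderiv ℝ f p) p :=
  (hf.differentiable (by simp)).differentiableAt.hasFDerivAt

theorem IsShapeField.hasFDerivAt (hB : IsShapeField X ν Ω c B) {p : Euc n} (hp : p ∈ Ω) :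
    HasFDerivAt B (fderiv ℝ B p) p :=
  ((hB.contDiffAt p hp).differentiableAt (by simp)).hasFDerivAt

theorem IsShapeField.hasFDerivAt_fderiv (hB : IsShapeField X ν Ω c B) {p : Euc n} (hp : p ∈ Ω) :
    HasFDerivAt (fderiv ℝ B) (fderiv ℝ (fderiv ℝ B) p) p :=
  (((hB.contDiffAt p hp).fderiv_right (m := 1) (by norm_cast)).differentiableAt
    (by simp)).hasFDerivAt

theorem IsShapeField.fderiv_fderiv_comm (hB : IsShapeField X ν Ω c B) {p : Euc n} (hp : p ∈ Ω)
    (u w : Euc n) : fderiv ℝ (fderiv ℝ B) p u w = fderiv ℝ (fderiv ℝ B) p w u :=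
  ((hB.contDiffAt p hp).isSymmSndFDerivAt (by simp; norm_cast)).eq u w

theorem IsExpanderPatch.eventually_mem (h : IsExpanderPatch X ν Ω κ) {p : Euc n} (hp : p ∈ Ω) :
    ∀ᶠ q in nhds p, q ∈ Ω :=
  h.isOpen.mem_nhds hp

/-- The eigenbasis of `B` at a point. -/
theorem IsExpanderPatch.exists_eigenbasis (h : IsExpanderPatch X ν Ω κ)
    (hB : IsShapeField X ν Ω c B) {p : Euc n} (hp : p ∈ Ω) :
    ∃ b : OrthonormalBasis (Option (Fin n)) ℝ (Euc (n + 1)),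
      ∀ o, B p (b o) = (o.elim c (κ p)) • b o := by
  obtain ⟨d, hd, hd'⟩ := h.frame p hp
  obtain ⟨b, hb0, hb⟩ := exists_orthonormalBasis_option hd (h.norm_normal p hp)
    (fun a => h.inner_normal p hp _)
  refine ⟨b, fun o => ?_⟩
  cases o with
  | none => simp [hb0, hB.apply_normal p hp]
  | some a => simp [hb, hB.apply_tangent p hp, hd']

theorem IsExpanderPatch.symm (h : IsExpanderPatch X ν Ω κ)
    (hB : IsShapeField X ν Ω c B) {p : Euc n} (hp : p ∈ Ω) (x y : Euc (n + 1)) :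
    ⟪B p x, y⟫ = ⟪x, B p y⟫ := by
  obtain ⟨b, hb⟩ := h.exists_eigenbasis hB hp
  rw [← b.sum_repr' x, ← b.sum_repr' y]
  simp only [map_sum, map_smul, hb, sum_inner, inner_sum, real_inner_smul_left,
    real_inner_smul_right, orthonormal_iff_ite.1 b.orthonormal]
  refine Finset.sum_congr rfl fun i _ => Finset.sum_congr rfl fun j _ => ?_
  split_ifs with hij
  · subst hij; ring
  · ring

theorem IsExpanderPatch.trace (h : IsExpanderPatch X ν Ω κ)
    (hB : IsShapeField X ν Ω c B) {p : Euc n} (hp : p ∈ Ω) {ι : Type*} [Fintype ι]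
    (e : OrthonormalBasis ι ℝ (Euc (n + 1))) :
    ∑ o, ⟪B p (e o), e o⟫ = ⟪X p, ν p⟫ + c := by
  obtain ⟨b, hb⟩ := h.exists_eigenbasis hB hp
  have h1 := LinearMap.trace_eq_sum_inner (B p : Euc (n + 1) →ₗ[ℝ] Euc (n + 1)) e
  have h2 := LinearMap.trace_eq_sum_inner (B p : Euc (n + 1) →ₗ[ℝ] Euc (n + 1)) b
  have h3 : ∑ o, ⟪b o, B p (b o)⟫ = ⟪X p, ν p⟫ + c := by
    rw [Fintype.sum_option, ← h.sum_curv p hp]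
    simp [hb, real_inner_smul_right]
    ring
  rw [← h3]
  simp only [real_inner_comm (e _)]
  exact h1.symm.trans h2

theorem IsExpanderPatch.symm_fderiv (h : IsExpanderPatch X ν Ω κ)
    (hB : IsShapeField X ν Ω c B) {p : Euc n} (hp : p ∈ Ω) (u : Euc n) (x y : Euc (n + 1)) :
    ⟪fderiv ℝ B p u x, y⟫ = ⟪x, fderiv ℝ B p u y⟫ := by
  have h1 := ((hB.hasFDerivAt hp).clm_apply (hasFDerivAt_const x p)).inner ℝ
    (hasFDerivAt_const y p)
  have h2 := (hasFDerivAt_const x p).inner ℝ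
    ((hB.hasFDerivAt hp).clm_apply (hasFDerivAt_const y p))
  have := h1.eq_of_eventuallyEq h2 ((h.eventually_mem hp).mono fun q hq => h.symm hB hq x y) u
  simpa [fderivInnerCLM_apply] using this

theorem IsExpanderPatch.symm_fderiv_fderiv (h : IsExpanderPatch X ν Ω κ)
    (hB : IsShapeField X ν Ω c B) {p : Euc n} (hp : p ∈ Ω) (u w : Euc n) (x y : Euc (n + 1)) :
    ⟪fderiv ℝ (fderiv ℝ B) p w u x, y⟫ = ⟪x, fderiv ℝ (fderiv ℝ B) p w u y⟫ := by
  have hu := (hB.hasFDerivAt_fderiv hp).clm_apply (hasFDerivAt_const u p)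
  have h1 := (hu.clm_apply (hasFDerivAt_const x p)).inner ℝ (hasFDerivAt_const y p)
  have h2 := (hasFDerivAt_const x p).inner ℝ (hu.clm_apply (hasFDerivAt_const y p))
  have := h1.eq_of_eventuallyEq h2
    ((h.eventually_mem hp).mono fun q hq => h.symm_fderiv hB hq u x y) w
  simpa [fderivInnerCLM_apply] using this

/-- Codazzi equation. -/
theorem IsExpanderPatch.codazzi (h : IsExpanderPatch X ν Ω κ)
    (hB : IsShapeField X ν Ω c B) {p : Euc n} (hp : p ∈ Ω) (u w : Euc n) :
    fderiv ℝ B p u (fderiv ℝ X p w) = fderiv ℝ B p w (fderiv ℝ X p u) := by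
  have key : ∀ u w, B p (fderiv ℝ (fderiv ℝ X) p w u) + fderiv ℝ B p w (fderiv ℝ X p u)
      = -fderiv ℝ (fderiv ℝ ν) p w u := by
    intro u w
    have h1 := (hB.hasFDerivAt hp).clm_apply
      ((h.contDiff.hasFDerivAt_fderiv p).clm_apply (hasFDerivAt_const u p))
    have h2 := ((h.contDiff_normal.hasFDerivAt_fderiv p).clm_apply (hasFDerivAt_const u p)).neg
    have := h1.eq_of_eventuallyEq h2
      ((h.eventually_mem hp).mono fun q hq => hB.apply_tangent q hq u) w
    simpa using this
  have h1 := key u w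
  have h2 := key w u
  rw [fderiv_fderiv_comm h.contDiff, fderiv_fderiv_comm h.contDiff_normal] at h1
  exact add_left_cancel (h2.trans h1.symm)

theorem IsExpanderPatch.fderiv_codazzi (h : IsExpanderPatch X ν Ω κ)
    (hB : IsShapeField X ν Ω c B) {p : Euc n} (hp : p ∈ Ω) (z u w : Euc n) :
    fderiv ℝ (fderiv ℝ B) p z u (fderiv ℝ X p w)
        + fderiv ℝ B p u (fderiv ℝ (fderiv ℝ X) p z w)
      = fderiv ℝ (fderiv ℝ B) p z w (fderiv ℝ X p u)
        + fderiv ℝ B p w (fderiv ℝ (fderiv ℝ X) p z u) := by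
  have key := fun u w => ((hB.hasFDerivAt_fderiv hp).clm_apply (hasFDerivAt_const u p)).clm_apply
      ((h.contDiff.hasFDerivAt_fderiv p).clm_apply (hasFDerivAt_const w p))
  have := (key u w).eq_of_eventuallyEq (key w u)
    ((h.eventually_mem hp).mono fun q hq => h.codazzi hB hq u w) z
  simp at this
  exact (add_comm _ _).trans (this.trans (add_comm _ _))

theorem IsExpanderPatch.fderiv_apply_normal (h : IsExpanderPatch X ν Ω κ)
    (hB : IsShapeField X ν Ω c B) {p : Euc n} (hp : p ∈ Ω) (u : Euc n) :
    fderiv ℝ B p u (ν p) + B p (fderiv ℝ ν p u) = c • fderiv ℝ ν p u := by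
  have h1 := (hB.hasFDerivAt hp).clm_apply (h.contDiff_normal.hasFDerivAt_self p)
  have h2 := (h.contDiff_normal.hasFDerivAt_self p).const_smul c
  have := h1.eq_of_eventuallyEq h2
    ((h.eventually_mem hp).mono fun q hq => hB.apply_normal q hq) u
  simp at this
  exact (add_comm _ _).trans this

theorem IsExpanderPatch.fderiv_fderiv_apply_normal (h : IsExpanderPatch X ν Ω κ)
    (hB : IsShapeField X ν Ω c B) {p : Euc n} (hp : p ∈ Ω) (u : Euc n) :
    ⟪fderiv ℝ (fderiv ℝ B) p u u (ν p), ν p⟫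
      = -2 * ⟪fderiv ℝ B p u (fderiv ℝ ν p u), ν p⟫ := by
  have h1 := (((hB.hasFDerivAt_fderiv hp).clm_apply (hasFDerivAt_const u p)).clm_apply
    (h.contDiff_normal.hasFDerivAt_self p)).add ((hB.hasFDerivAt hp).clm_apply
      ((h.contDiff_normal.hasFDerivAt_fderiv p).clm_apply (hasFDerivAt_const u p)))
  have h2 := ((h.contDiff_normal.hasFDerivAt_fderiv p).clm_apply
    (hasFDerivAt_const u p)).const_smul c
  have h3 := h1.eq_of_eventuallyEq h2
    ((h.eventually_mem hp).mono fun q hq => h.fderiv_apply_normal hB hq u) u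
  simp at h3
  have h4 := congrArg (fun v => ⟪v, ν p⟫) h3
  simp only [inner_add_left, real_inner_smul_left] at h4
  have h5 : ⟪B p (fderiv ℝ (fderiv ℝ ν) p u u), ν p⟫
      = c * ⟪fderiv ℝ (fderiv ℝ ν) p u u, ν p⟫ := by
    rw [h.symm hB hp, hB.apply_normal p hp, real_inner_smul_right]
  linarith

theorem IsExpanderPatch.inner_fderiv_fderiv_normal (h : IsExpanderPatch X ν Ω κ)
    {p : Euc n} (hp : p ∈ Ω) (u w : Euc n) :
    ⟪fderiv ℝ (fderiv ℝ X) p w u, ν p⟫ = -⟪fderiv ℝ X p u, fderiv ℝ ν p w⟫ := by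
  have h1 := ((h.contDiff.hasFDerivAt_fderiv p).clm_apply (hasFDerivAt_const u p)).inner ℝ
    (h.contDiff_normal.hasFDerivAt_self p)
  have := h1.eq_of_eventuallyEq (hasFDerivAt_const (0 : ℝ) p)
    ((h.eventually_mem hp).mono fun q hq => h.inner_normal q hq u) w
  simp [fderivInnerCLM_apply] at this
  linarith

/-- The support function of a patch. -/
def support {n : ℕ} (X ν : Euc n → Euc (n + 1)) (p : Euc n) : ℝ := ⟪X p, ν p⟫

theorem IsExpanderPatch.contDiff_support (h : IsExpanderPatch X ν Ω κ) :
    ContDiff ℝ (⊤ : ℕ∞) (support X ν) :=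
  h.contDiff.inner ℝ h.contDiff_normal

theorem IsExpanderPatch.fderiv_support (h : IsExpanderPatch X ν Ω κ)
    (hB : IsShapeField X ν Ω c B) {p : Euc n} (hp : p ∈ Ω) (u : Euc n) :
    fderiv ℝ (support X ν) p u = -⟪X p, B p (fderiv ℝ X p u)⟫ := by
  have h1 := (h.contDiff.hasFDerivAt_self p).inner ℝ (h.contDiff_normal.hasFDerivAt_self p)
  have h2 := h.contDiff_support.hasFDerivAt_self p
  rw [h2.unique h1, hB.apply_tangent p hp]
  simp [fderivInnerCLM_apply, h.inner_normal p hp]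

theorem IsExpanderPatch.fderiv_fderiv_support (h : IsExpanderPatch X ν Ω κ)
    (hB : IsShapeField X ν Ω c B) {p : Euc n} (hp : p ∈ Ω) (z u : Euc n) :
    fderiv ℝ (fderiv ℝ (support X ν)) p z u = -⟪fderiv ℝ X p z, B p (fderiv ℝ X p u)⟫
      - ⟪X p, fderiv ℝ B p z (fderiv ℝ X p u)⟫
      - ⟪X p, B p (fderiv ℝ (fderiv ℝ X) p z u)⟫ := by
  have h1 := ((h.contDiff.hasFDerivAt_self p).inner ℝ ((hB.hasFDerivAt hp).clm_apply
    ((h.contDiff.hasFDerivAt_fderiv p).clm_apply (hasFDerivAt_const u p)))).neg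
  have h2 := (h.contDiff_support.hasFDerivAt_fderiv p).clm_apply (hasFDerivAt_const u p)
  have := h2.eq_of_eventuallyEq h1
    ((h.eventually_mem hp).mono fun q hq => h.fderiv_support hB hq u) z
  simp [fderivInnerCLM_apply, inner_add_right] at this
  rw [this]; ring

theorem IsExpanderPatch.trace_fderiv (h : IsExpanderPatch X ν Ω κ)
    (hB : IsShapeField X ν Ω c B) {p : Euc n} (hp : p ∈ Ω) {ι : Type*} [Fintype ι]
    (e : OrthonormalBasis ι ℝ (Euc (n + 1))) (u : Euc n) :
    ∑ o, ⟪fderiv ℝ B p u (e o), e o⟫ = fderiv ℝ (support X ν) p u := by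
  have h1 := HasFDerivAt.fun_sum (u := Finset.univ) fun o (_ : o ∈ Finset.univ) =>
    ((hB.hasFDerivAt hp).clm_apply (hasFDerivAt_const (e o) p)).inner ℝ
      (hasFDerivAt_const (e o) p)
  have h2 := (h.contDiff_support.hasFDerivAt_self p).add_const c
  have := h1.eq_of_eventuallyEq h2
    ((h.eventually_mem hp).mono fun q hq => h.trace hB hq e) u
  simpa [fderivInnerCLM_apply] using this

theorem IsExpanderPatch.trace_fderiv_fderiv (h : IsExpanderPatch X ν Ω κ)
    (hB : IsShapeField X ν Ω c B) {p : Euc n} (hp : p ∈ Ω) {ι : Type*} [Fintype ι]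
    (e : OrthonormalBasis ι ℝ (Euc (n + 1))) (z u : Euc n) :
    ∑ o, ⟪fderiv ℝ (fderiv ℝ B) p z u (e o), e o⟫
      = fderiv ℝ (fderiv ℝ (support X ν)) p z u := by
  have h1 := HasFDerivAt.fun_sum (u := Finset.univ) fun o (_ : o ∈ Finset.univ) =>
    (((hB.hasFDerivAt_fderiv hp).clm_apply (hasFDerivAt_const u p)).clm_apply
      (hasFDerivAt_const (e o) p)).inner ℝ (hasFDerivAt_const (e o) p)
  have h2 := (h.contDiff_support.hasFDerivAt_fderiv p).clm_apply (hasFDerivAt_const u p)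
  have := h1.eq_of_eventuallyEq h2
    ((h.eventually_mem hp).mono fun q hq => h.trace_fderiv hB hq e u) z
  simpa [fderivInnerCLM_apply] using this

end ShapeField

/-- A vector is determined by its components along `T a` and `N`. -/
theorem ext_inner_frame {n : ℕ} {T : Fin n → Euc (n + 1)} {N : Euc (n + 1)}
    (hT : ∀ a b, ⟪T a, T b⟫ = if a = b then (1 : ℝ) else 0) (hN : ‖N‖ = 1)
    (hTN : ∀ a, ⟪T a, N⟫ = (0 : ℝ)) {x y : Euc (n + 1)} (h : ∀ a, ⟪T a, x⟫ = ⟪T a, y⟫)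
    (h' : ⟪N, x⟫ = ⟪N, y⟫) : x = y := by
  obtain ⟨b, hb0, hb⟩ := exists_orthonormalBasis_option hT hN hTN
  refine InnerProductSpace.ext_inner_left_basis b.toBasis fun o => ?_
  cases o with
  | none => simpa [hb0] using h'
  | some a => simpa [hb] using h a

section Frame

variable {n : ℕ} {X ν : Euc n → Euc (n + 1)} {Ω : Set (Euc n)} {κ : Euc n → Fin n → ℝ} {c : ℝ}
  {B : Euc n → Euc (n + 1) →L[ℝ] Euc (n + 1)} {p : Euc n} {d : Fin n → Euc n}

theorem IsExpanderPatch.apply_frame (hB : IsShapeField X ν Ω c B) (hp : p ∈ Ω)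
    (hd' : ∀ a, fderiv ℝ ν p (d a) = -κ p a • fderiv ℝ X p (d a)) (a : Fin n) :
    B p (fderiv ℝ X p (d a)) = κ p a • fderiv ℝ X p (d a) := by
  rw [hB.apply_tangent p hp, hd']; simp

theorem IsExpanderPatch.fderiv_apply_normal_frame (h : IsExpanderPatch X ν Ω κ)
    (hB : IsShapeField X ν Ω c B) (hp : p ∈ Ω)
    (hd' : ∀ a, fderiv ℝ ν p (d a) = -κ p a • fderiv ℝ X p (d a)) (a : Fin n) :
    fderiv ℝ B p (d a) (ν p) = (κ p a ^ 2 - c * κ p a) • fderiv ℝ X p (d a) := by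
  have h1 := h.fderiv_apply_normal hB hp (d a)
  rw [hd', map_smul, apply_frame hB hp hd'] at h1
  rw [← sub_eq_zero] at h1 ⊢
  rw [← h1]
  module

theorem IsExpanderPatch.fderiv_inner_normal_frame (h : IsExpanderPatch X ν Ω κ)
    (hB : IsShapeField X ν Ω c B) (hp : p ∈ Ω)
    (hd : ∀ a b, ⟪fderiv ℝ X p (d a), fderiv ℝ X p (d b)⟫ = if a = b then (1 : ℝ) else 0)
    (hd' : ∀ a, fderiv ℝ ν p (d a) = -κ p a • fderiv ℝ X p (d a)) (a i : Fin n) :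
    ⟪fderiv ℝ B p (d a) (fderiv ℝ X p (d i)), ν p⟫
      = if i = a then κ p a ^ 2 - c * κ p a else 0 := by
  rw [h.symm_fderiv hB hp, h.fderiv_apply_normal_frame hB hp hd', real_inner_smul_right, hd]
  split_ifs <;> simp

theorem IsExpanderPatch.fderiv_support_frame (h : IsExpanderPatch X ν Ω κ)
    (hB : IsShapeField X ν Ω c B) (hp : p ∈ Ω)
    (hd' : ∀ a, fderiv ℝ ν p (d a) = -κ p a • fderiv ℝ X p (d a)) (a : Fin n) :
    fderiv ℝ (support X ν) p (d a) = -(κ p a * ⟪X p, fderiv ℝ X p (d a)⟫) := by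
  rw [h.fderiv_support hB hp, apply_frame hB hp hd', real_inner_smul_right]

theorem IsExpanderPatch.trace_fderiv_frame (h : IsExpanderPatch X ν Ω κ)
    (hB : IsShapeField X ν Ω c B) (hp : p ∈ Ω)
    (hd : ∀ a b, ⟪fderiv ℝ X p (d a), fderiv ℝ X p (d b)⟫ = if a = b then (1 : ℝ) else 0)
    (hd' : ∀ a, fderiv ℝ ν p (d a) = -κ p a • fderiv ℝ X p (d a)) (a : Fin n) :
    fderiv ℝ (support X ν) p (d a)
      = ∑ i, ⟪fderiv ℝ B p (d a) (fderiv ℝ X p (d i)), fderiv ℝ X p (d i)⟫ := by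
  obtain ⟨b, hb0, hb⟩ := exists_orthonormalBasis_option hd (h.norm_normal p hp)
    (fun a => h.inner_normal p hp _)
  rw [← h.trace_fderiv hB hp b, Fintype.sum_option, hb0,
    h.fderiv_apply_normal_frame hB hp hd', real_inner_smul_left, h.inner_normal p hp]
  simp [hb]

/-- The position vector minus the trace of the second derivative is tangent. -/
theorem IsExpanderPatch.sub_sum_eq (h : IsExpanderPatch X ν Ω κ) (hp : p ∈ Ω)
    (hd : ∀ a b, ⟪fderiv ℝ X p (d a), fderiv ℝ X p (d b)⟫ = if a = b then (1 : ℝ) else 0)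
    (hd' : ∀ a, fderiv ℝ ν p (d a) = -κ p a • fderiv ℝ X p (d a)) :
    X p - ∑ b, fderiv ℝ (fderiv ℝ X) p (d b) (d b)
      = ∑ a, ⟪X p - ∑ b, fderiv ℝ (fderiv ℝ X) p (d b) (d b), fderiv ℝ X p (d a)⟫
          • fderiv ℝ X p (d a) := by
  refine ext_inner_frame hd (h.norm_normal p hp) (fun a => h.inner_normal p hp _)
    (fun a => ?_) ?_
  · simp only [inner_sum, real_inner_smul_right, hd]
    simp [real_inner_comm]
  · have h1 : ∀ b, ⟪ν p, fderiv ℝ (fderiv ℝ X) p (d b) (d b)⟫ = κ p b := by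
      intro b
      rw [real_inner_comm, h.inner_fderiv_fderiv_normal hp, hd', real_inner_smul_right, hd]
      simp
    simp only [inner_sub_right, inner_sum, real_inner_smul_right, h1]
    rw [real_inner_comm, h.sum_curv p hp, sub_self, eq_comm]
    refine Finset.sum_eq_zero fun a _ => ?_
    rw [real_inner_comm (fderiv ℝ X p (d a)) (ν p), h.inner_normal p hp, mul_zero]

theorem IsExpanderPatch.sum_add_eq (h : IsExpanderPatch X ν Ω κ)
    (hB : IsShapeField X ν Ω c B) (hp : p ∈ Ω)
    (hd : ∀ a b, ⟪fderiv ℝ X p (d a), fderiv ℝ X p (d b)⟫ = if a = b then (1 : ℝ) else 0)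
    (hd' : ∀ a, fderiv ℝ ν p (d a) = -κ p a • fderiv ℝ X p (d a)) :
    (∑ a, fderiv ℝ B p (d a) (fderiv ℝ X p (d a))) + B p (X p)
      = (∑ a, κ p a ^ 2) • ν p := by
  refine ext_inner_frame hd (h.norm_normal p hp) (fun a => h.inner_normal p hp _)
    (fun i => ?_) ?_
  · have h1 : ∀ a, ⟪fderiv ℝ X p (d i), fderiv ℝ B p (d a) (fderiv ℝ X p (d a))⟫
        = ⟪fderiv ℝ B p (d i) (fderiv ℝ X p (d a)), fderiv ℝ X p (d a)⟫ := fun a => by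
      rw [← h.symm_fderiv hB hp, h.codazzi hB hp]
    rw [inner_add_right, inner_sum, Finset.sum_congr rfl fun a _ => h1 a,
      ← h.trace_fderiv_frame hB hp hd hd', h.fderiv_support_frame hB hp hd',
      ← h.symm hB hp, apply_frame hB hp hd', real_inner_smul_left, real_inner_smul_right,
      h.inner_normal p hp, real_inner_comm (X p)]
    ring
  · have h1 : ∀ a, ⟪ν p, fderiv ℝ B p (d a) (fderiv ℝ X p (d a))⟫ = κ p a ^ 2 - c * κ p a :=
      fun a => by
        rw [real_inner_comm, h.fderiv_inner_normal_frame hB hp hd hd', if_pos rfl]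
    rw [inner_add_right, inner_sum, Finset.sum_congr rfl fun a _ => h1 a, ← h.symm hB hp,
      hB.apply_normal p hp, real_inner_smul_left, real_inner_smul_right, real_inner_self_eq_norm_sq,
      h.norm_normal p hp, real_inner_comm (X p), ← h.sum_curv p hp, Finset.sum_sub_distrib,
      ← Finset.mul_sum]
    ring

/-- The equation satisfied by the support function. -/
theorem IsExpanderPatch.sum_fderiv_fderiv_support (h : IsExpanderPatch X ν Ω κ)
    (hB : IsShapeField X ν Ω c B) (hp : p ∈ Ω)
    (hd : ∀ a b, ⟪fderiv ℝ X p (d a), fderiv ℝ X p (d b)⟫ = if a = b then (1 : ℝ) else 0)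
    (hd' : ∀ a, fderiv ℝ ν p (d a) = -κ p a • fderiv ℝ X p (d a)) :
    ∑ a, fderiv ℝ (fderiv ℝ (support X ν)) p (d a) (d a)
      + ∑ a, ⟪X p - ∑ b, fderiv ℝ (fderiv ℝ X) p (d b) (d b), fderiv ℝ X p (d a)⟫
          * fderiv ℝ (support X ν) p (d a)
      = -((1 + ∑ a, κ p a ^ 2) * support X ν p) := by
  have h1 : ∀ a, fderiv ℝ (fderiv ℝ (support X ν)) p (d a) (d a) = -κ p a
      - ⟪X p, fderiv ℝ B p (d a) (fderiv ℝ X p (d a))⟫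
      - ⟪B p (X p), fderiv ℝ (fderiv ℝ X) p (d a) (d a)⟫ := by
    intro a
    rw [h.fderiv_fderiv_support hB hp, apply_frame hB hp hd', real_inner_smul_right, hd,
      h.symm hB hp]
    simp
  have h2 : ⟪X p, (∑ a, fderiv ℝ B p (d a) (fderiv ℝ X p (d a))) + B p (X p)⟫
      = (∑ a, κ p a ^ 2) * support X ν p := by
    rw [h.sum_add_eq hB hp hd hd', real_inner_smul_right, support]
  have h3 : ⟪B p (X p), X p - ∑ b, fderiv ℝ (fderiv ℝ X) p (d b) (d b)⟫
      = ∑ a, ⟪X p - ∑ b, fderiv ℝ (fderiv ℝ X) p (d b) (d b), fderiv ℝ X p (d a)⟫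
          * (κ p a * ⟪X p, fderiv ℝ X p (d a)⟫) := by
    conv_lhs => rw [h.sub_sum_eq hp hd hd']
    rw [inner_sum]
    refine Finset.sum_congr rfl fun a _ => ?_
    rw [real_inner_smul_right, h.symm hB hp, apply_frame hB hp hd', real_inner_smul_right]
  have h4 : support X ν p = ∑ a, κ p a := (h.sum_curv p hp).symm
  rw [inner_add_right, inner_sum] at h2
  rw [inner_sub_right, inner_sum] at h3
  simp only [h1, h.fderiv_support_frame hB hp hd', mul_neg, Finset.sum_neg_distrib,
    Finset.sum_sub_distrib]
  rw [← h3, real_inner_comm (X p) (B p (X p)), one_add_mul, ← h2, h4]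
  ring

/-- Simons type identity. -/
theorem IsExpanderPatch.sum_fderiv_fderiv_shape (h : IsExpanderPatch X ν Ω κ)
    (hB : IsShapeField X ν Ω c B) (hp : p ∈ Ω)
    (hd : ∀ a b, ⟪fderiv ℝ X p (d a), fderiv ℝ X p (d b)⟫ = if a = b then (1 : ℝ) else 0)
    (hd' : ∀ a, fderiv ℝ ν p (d a) = -κ p a • fderiv ℝ X p (d a)) (i : Fin n) :
    ∑ a, ⟪fderiv ℝ (fderiv ℝ B) p (d a) (d a) (fderiv ℝ X p (d i)), fderiv ℝ X p (d i)⟫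
      + ∑ a, ⟪X p - ∑ b, fderiv ℝ (fderiv ℝ X) p (d b) (d b), fderiv ℝ X p (d a)⟫
          * ⟪fderiv ℝ B p (d a) (fderiv ℝ X p (d i)), fderiv ℝ X p (d i)⟫
      = -((1 + ∑ a, κ p a ^ 2) * κ p i) - 2 * κ p i * (κ p i ^ 2 - c * κ p i) := by
  have h1 : ∀ a, ⟪fderiv ℝ (fderiv ℝ B) p (d a) (d a) (fderiv ℝ X p (d i)), fderiv ℝ X p (d i)⟫
      = ⟪fderiv ℝ (fderiv ℝ B) p (d i) (d i) (fderiv ℝ X p (d a)), fderiv ℝ X p (d a)⟫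
        - ⟪fderiv ℝ (fderiv ℝ X) p (d i) (d i), fderiv ℝ B p (d a) (fderiv ℝ X p (d a))⟫
        + ⟪fderiv ℝ (fderiv ℝ X) p (d a) (d a), fderiv ℝ B p (d i) (fderiv ℝ X p (d i))⟫ := by
    intro a
    have e1 := congrArg (fun v => ⟪v, fderiv ℝ X p (d i)⟫)
      (h.fderiv_codazzi hB hp (d a) (d a) (d i))
    have e2 := congrArg (fun v => ⟪v, fderiv ℝ X p (d a)⟫)
      (h.fderiv_codazzi hB hp (d i) (d a) (d i))
    simp only [inner_add_left, h.symm_fderiv hB hp] at e1 e2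
    rw [fderiv_fderiv_comm h.contDiff p (d i) (d a), ← h.codazzi hB hp (d a) (d i),
      hB.fderiv_fderiv_comm hp (d i) (d a), h.symm_fderiv_fderiv hB hp, real_inner_comm] at e2
    linarith
  have h2 : ∑ a, ⟪fderiv ℝ (fderiv ℝ B) p (d i) (d i) (fderiv ℝ X p (d a)), fderiv ℝ X p (d a)⟫
      = fderiv ℝ (fderiv ℝ (support X ν)) p (d i) (d i)
        - 2 * κ p i * (κ p i ^ 2 - c * κ p i) := by
    obtain ⟨b, hb0, hb⟩ := exists_orthonormalBasis_option hd (h.norm_normal p hp)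
      (fun a => h.inner_normal p hp _)
    rw [← h.trace_fderiv_fderiv hB hp b, Fintype.sum_option, hb0,
      h.fderiv_fderiv_apply_normal hB hp, hd', map_smul, real_inner_smul_left,
      h.fderiv_inner_normal_frame hB hp hd hd', if_pos rfl]
    simp only [hb]
    ring
  have h3 : fderiv ℝ (fderiv ℝ (support X ν)) p (d i) (d i) = -κ p i
      - ⟪X p, fderiv ℝ B p (d i) (fderiv ℝ X p (d i))⟫
      - ⟪B p (X p), fderiv ℝ (fderiv ℝ X) p (d i) (d i)⟫ := by
    rw [h.fderiv_fderiv_support hB hp, apply_frame hB hp hd', real_inner_smul_right, hd,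
      h.symm hB hp]
    simp
  have h4 : ⟪fderiv ℝ (fderiv ℝ X) p (d i) (d i),
      (∑ a, fderiv ℝ B p (d a) (fderiv ℝ X p (d a))) + B p (X p)⟫
      = (∑ a, κ p a ^ 2) * κ p i := by
    rw [h.sum_add_eq hB hp hd hd', real_inner_smul_right, h.inner_fderiv_fderiv_normal hp, hd',
      real_inner_smul_right, hd]
    simp
  have h5 : ⟪X p - ∑ b, fderiv ℝ (fderiv ℝ X) p (d b) (d b),
      fderiv ℝ B p (d i) (fderiv ℝ X p (d i))⟫
      = ∑ a, ⟪X p - ∑ b, fderiv ℝ (fderiv ℝ X) p (d b) (d b), fderiv ℝ X p (d a)⟫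
          * ⟪fderiv ℝ B p (d a) (fderiv ℝ X p (d i)), fderiv ℝ X p (d i)⟫ := by
    conv_lhs => rw [h.sub_sum_eq hp hd hd']
    rw [sum_inner]
    refine Finset.sum_congr rfl fun a _ => ?_
    rw [real_inner_smul_left, ← h.symm_fderiv hB hp, h.codazzi hB hp]
  rw [inner_add_right, inner_sum] at h4
  rw [← h5, inner_sub_left, sum_inner]
  simp only [h1, Finset.sum_add_distrib, Finset.sum_sub_distrib]
  rw [h2, h3, one_add_mul, ← h4, real_inner_comm (B p (X p))]
  ring

end Frame

theorem ContDiffAt.exists_hasDerivAt {G : ℝ → ℝ} (hG : ContDiffAt ℝ 2 G 0) :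
    ∃ (G' : ℝ → ℝ) (g₂ : ℝ), (∀ᶠ t in nhds (0 : ℝ), HasDerivAt G (G' t) t) ∧
      HasDerivAt G' g₂ 0 := by
  refine ⟨deriv G, deriv (deriv G) 0, ?_, ?_⟩
  · have := hG.eventually (by simp)
    exact this.mono fun t ht => (ht.differentiableAt (by simp)).hasDerivAt
  · have h1 : ContDiffAt ℝ 1 (fderiv ℝ G) 0 := hG.fderiv_right (by norm_num)
    have h2 : deriv G = fun t => fderiv ℝ G t 1 := by ext t; simp
    rw [h2]
    exact ((h1.differentiableAt (by simp)).clm_apply (differentiableAt_const _)).hasDerivAt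

/-- First and second order conditions at a point where a smooth function touches from below the
sum of the lowest eigenvalues of a family of symmetric operators. -/
theorem second_order_sum_lowest_eigenvalues {E ι : Type*} [NormedAddCommGroup E]
    [InnerProductSpace ℝ E] [Fintype ι] [DecidableEq ι] {B B' : ℝ → E →L[ℝ] E} {B₂ : E →L[ℝ] E}
    (hBc : ContDiffAt ℝ 2 B 0) (hB : ∀ᶠ t in nhds (0 : ℝ), HasDerivAt B (B' t) t)
    (hB' : HasDerivAt B' B₂ 0) (hsymm : ∀ x y, ⟪B' 0 x, y⟫ = ⟪x, B' 0 y⟫)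
    {u u' : ℝ → ℝ} {u₂ : ℝ} (hu : ∀ᶠ t in nhds (0 : ℝ), HasDerivAt u (u' t) t)
    (hu' : HasDerivAt u' u₂ 0) (b : OrthonormalBasis ι ℝ E) (β : ι → ℝ)
    (hb : ∀ α, B 0 (b α) = β α • b α) (J : Finset ι) (hgap : ∀ i ∈ J, ∀ α ∉ J, β i < β α)
    {f : ℝ → ℝ} (hf0 : f 0 = ∑ i ∈ J, β i) {c : ℝ}
    (hf : ∀ᶠ t in nhds (0 : ℝ), ∃ (b' : OrthonormalBasis ι ℝ E) (β' : ι → ℝ) (m : ℝ), m ≤ c ∧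
      (∀ α, B t (b' α) = β' α • b' α) ∧ (∀ α ∈ J, β' α ≤ m) ∧ (∀ α ∉ J, m ≤ β' α) ∧
      f t = ∑ α ∈ J, β' α)
    (hmin : IsLocalMin (fun t => f t - u t) 0) :
    u' 0 = ∑ i ∈ J, ⟪B' 0 (b i), b i⟫ ∧
      u₂ ≤ ∑ i ∈ J, ⟪B₂ (b i), b i⟫
        - 2 * ∑ i ∈ J, ∑ α ∈ Jᶜ, ⟪B' 0 (b i), b α⟫ ^ 2 / (β α - β i) := by
  set r : ι → ι → ℝ := fun i α => -⟪B' 0 (b i), b α⟫ / (β α - β i) with hr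
  set ρ : ι → E := fun i => ∑ α ∈ Jᶜ, r i α • b α with hρ
  have hbb := orthonormal_iff_ite.1 b.orthonormal
  have hbρ : ∀ i ∈ J, ∀ j, ⟪b i, ρ j⟫ = 0 := by
    intro i hi j
    rw [hρ, inner_sum]
    refine Finset.sum_eq_zero fun α hα => ?_
    rw [real_inner_smul_right, hbb, if_neg, mul_zero]
    rintro rfl
    exact Finset.mem_compl.1 hα hi
  have hρb : ∀ i ∈ J, ∀ j, ⟪ρ j, b i⟫ = 0 := fun i hi j => by
    rw [real_inner_comm, hbρ i hi]
  have hρρ : ∀ i, ⟪ρ i, ρ i⟫ = ∑ α ∈ Jᶜ, r i α ^ 2 := by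
    intro i
    simp only [hρ, sum_inner, inner_sum, real_inner_smul_left, real_inner_smul_right, hbb]
    refine Finset.sum_congr rfl fun α hα => ?_
    simp only [mul_ite, mul_one, mul_zero]
    rw [Finset.sum_ite_eq' Jᶜ α, if_pos hα]; ring
  have hBρ : ∀ i, ⟪B 0 (ρ i), ρ i⟫ = ∑ α ∈ Jᶜ, β α * r i α ^ 2 := by
    intro i
    simp only [hρ, map_sum, map_smul, hb, sum_inner, inner_sum, real_inner_smul_left,
      real_inner_smul_right, hbb]
    refine Finset.sum_congr rfl fun α hα => ?_
    simp only [mul_ite, mul_one, mul_zero]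
    rw [Finset.sum_ite_eq' Jᶜ α, if_pos hα]; ring
  have hB'ρ : ∀ i, ⟪B' 0 (b i), ρ i⟫ = ∑ α ∈ Jᶜ, r i α * ⟪B' 0 (b i), b α⟫ := by
    intro i
    simp only [hρ, inner_sum, real_inner_smul_right]
  set A : ℝ → ℝ := fun t => ∑ i ∈ J, ⟪B t (b i), b i⟫ - u t with hA
  set D : ℝ → ℝ := fun t => ∑ i ∈ J, (⟪B t (b i), ρ i⟫ + ⟪B t (ρ i), b i⟫) with hD
  set G : ℝ → ℝ := fun t => ∑ i ∈ J, ⟪B t (ρ i), ρ i⟫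
    - ∑ i ∈ J, ∑ j ∈ J, ⟪ρ i, ρ j⟫ * ⟪B t (b i + t • ρ i), b j + t • ρ j⟫
    + c * (t ^ 2 * ∑ i ∈ J, ∑ j ∈ J, ⟪ρ i, ρ j⟫ ^ 2) with hG
  have hder : ∀ x y : E, (∀ᶠ t in nhds (0 : ℝ), HasDerivAt (fun t => ⟪B t x, y⟫) ⟪B' t x, y⟫ t) ∧
      HasDerivAt (fun t => ⟪B' t x, y⟫) ⟪B₂ x, y⟫ 0 := by
    intro x y
    constructor
    · filter_upwards [hB] with t ht
      have := (ht.clm_apply (hasDerivAt_const t x)).inner ℝ (hasDerivAt_const t y)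
      simpa using this
    · have := (hB'.clm_apply (hasDerivAt_const 0 x)).inner ℝ (hasDerivAt_const 0 y)
      simpa using this
  have hall : ∀ᶠ t in nhds (0 : ℝ), ∀ i ∈ J, HasDerivAt (fun t => ⟪B t (b i), b i⟫) ⟪B' t (b i), b i⟫ t ∧
      HasDerivAt (fun t => ⟪B t (b i), ρ i⟫) ⟪B' t (b i), ρ i⟫ t ∧
      HasDerivAt (fun t => ⟪B t (ρ i), b i⟫) ⟪B' t (ρ i), b i⟫ t :=
    (Filter.eventually_all_finset J).2 fun i _ =>
      (hder _ _).1.and ((hder _ _).1.and (hder _ _).1)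
  have hA1 : ∀ᶠ t in nhds (0 : ℝ), HasDerivAt A (∑ i ∈ J, ⟪B' t (b i), b i⟫ - u' t) t := by
    filter_upwards [hall, hu] with t ht hut
    exact (HasDerivAt.fun_sum fun i hi => (ht i hi).1).sub hut
  have hA2 : HasDerivAt (fun t => ∑ i ∈ J, ⟪B' t (b i), b i⟫ - u' t)
      (∑ i ∈ J, ⟪B₂ (b i), b i⟫ - u₂) 0 :=
    (HasDerivAt.fun_sum fun i _ => (hder _ _).2).sub hu'
  have hD1 : ∀ᶠ t in nhds (0 : ℝ),
      HasDerivAt D (∑ i ∈ J, (⟪B' t (b i), ρ i⟫ + ⟪B' t (ρ i), b i⟫)) t := by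
    filter_upwards [hall] with t ht
    exact HasDerivAt.fun_sum fun i hi => (ht i hi).2.1.add (ht i hi).2.2
  have hD2 : HasDerivAt (fun t => ∑ i ∈ J, (⟪B' t (b i), ρ i⟫ + ⟪B' t (ρ i), b i⟫))
      (∑ i ∈ J, (⟪B₂ (b i), ρ i⟫ + ⟪B₂ (ρ i), b i⟫)) 0 :=
    HasDerivAt.fun_sum fun i _ => (hder _ _).2.add (hder _ _).2
  have hGc : ContDiffAt ℝ 2 G 0 := by
    have hs : ∀ x y : E, ContDiffAt ℝ 2 (fun t : ℝ => x + t • y) 0 := fun x y => by fun_prop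
    have h1 : ∀ i, ContDiffAt ℝ 2 (fun t => ⟪B t (ρ i), ρ i⟫) 0 := fun i =>
      (hBc.clm_apply contDiffAt_const).inner ℝ contDiffAt_const
    have h2 : ∀ i j, ContDiffAt ℝ 2 (fun t => ⟪B t (b i + t • ρ i), b j + t • ρ j⟫) 0 :=
      fun i j => (hBc.clm_apply (hs _ _)).inner ℝ (hs _ _)
    exact ((ContDiffAt.sum fun i _ => h1 i).sub (ContDiffAt.sum fun i _ => ContDiffAt.sum
      fun j _ => contDiffAt_const.mul (h2 i j))).add
        (contDiffAt_const.mul ((contDiffAt_id.pow 2).mul contDiffAt_const))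
  obtain ⟨G', g₂, hG1, hG2⟩ := hGc.exists_hasDerivAt
  have hFeq : ∀ t, A t + t * D t + t ^ 2 * G t = ∑ i ∈ J, ⟪B t (b i + t • ρ i), b i + t • ρ i⟫
      - t ^ 2 * ∑ i ∈ J, ∑ j ∈ J, ⟪ρ i, ρ j⟫ * ⟪B t (b i + t • ρ i), b j + t • ρ j⟫
      + c * (t ^ 4 * ∑ i ∈ J, ∑ j ∈ J, ⟪ρ i, ρ j⟫ ^ 2) - u t := by
    intro t
    have : ∑ i ∈ J, ⟪B t (b i + t • ρ i), b i + t • ρ i⟫ = ∑ i ∈ J, ⟪B t (b i), b i⟫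
        + t * ∑ i ∈ J, (⟪B t (b i), ρ i⟫ + ⟪B t (ρ i), b i⟫)
        + t ^ 2 * ∑ i ∈ J, ⟪B t (ρ i), ρ i⟫ := by
      rw [Finset.mul_sum, Finset.mul_sum, ← Finset.sum_add_distrib, ← Finset.sum_add_distrib]
      refine Finset.sum_congr rfl fun i _ => ?_
      simp only [map_add, map_smul, inner_add_left, inner_add_right, real_inner_smul_left,
        real_inner_smul_right]
      ring
    rw [this]
    simp only [hA, hD, hG]
    ring
  have hmin' : IsLocalMin (fun t => A t + t * D t + t ^ 2 * G t) 0 := by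
    have hsmall : ∀ᶠ t in nhds (0 : ℝ), t ^ 2 * ∑ i ∈ J, ‖ρ i‖ ^ 2 < 1 := by
      have : Filter.Tendsto (fun t : ℝ => t ^ 2 * ∑ i ∈ J, ‖ρ i‖ ^ 2) (nhds 0)
          (nhds (0 ^ 2 * ∑ i ∈ J, ‖ρ i‖ ^ 2)) :=
        (Continuous.tendsto (by fun_prop) 0)
      exact this.eventually_lt_const (by simp)
    filter_upwards [hf, hmin, hsmall] with t ht hmt hst
    obtain ⟨b', β', m, hmc, hb', hm1, hm2, hft⟩ := ht
    have h1 := sum_lowest_eigenvalues_le b' (B t) β' hb' hmc J hm1 hm2 J rfl b ρ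
      (fun i _ j _ => hbb i j) (fun i hi j _ => hbρ i hi j) t hst.le
    have h0 : ∑ i ∈ J, ⟪B 0 (b i), b i⟫ = ∑ i ∈ J, β i :=
      Finset.sum_congr rfl fun i _ => by rw [hb, real_inner_smul_left, hbb, if_pos rfl, mul_one]
    have h2 : A 0 + 0 * D 0 + 0 ^ 2 * G 0 = f 0 - u 0 := by
      simp only [hA, h0, hf0]; ring
    rw [h2, hFeq]
    linarith
  obtain ⟨e1, e2⟩ := second_order_of_isLocalMin hA1 hA2 hD1 hD2 hG1 hG2 hmin'
  have hD0 : D 0 = 0 := by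
    refine Finset.sum_eq_zero fun i hi => ?_
    have : B 0 (ρ i) = ∑ α ∈ Jᶜ, (r i α * β α) • b α := by
      simp only [hρ, map_sum, map_smul, hb, smul_smul]
    rw [hb, real_inner_smul_left, hbρ i hi, this, sum_inner, mul_zero, zero_add]
    refine Finset.sum_eq_zero fun α hα => ?_
    rw [real_inner_smul_left, hbb, if_neg, mul_zero]
    rintro rfl
    exact Finset.mem_compl.1 hα hi
  refine ⟨by rw [hD0] at e1; linarith, ?_⟩
  have hG0 : G 0 = ∑ i ∈ J, ∑ α ∈ Jᶜ, ⟪B' 0 (b i), b α⟫ ^ 2 / (β α - β i) := by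
    have h1 : ∀ i ∈ J, ∑ j ∈ J, ⟪ρ i, ρ j⟫ * ⟪B 0 (b i + (0 : ℝ) • ρ i), b j + (0 : ℝ) • ρ j⟫
        = β i * ⟪ρ i, ρ i⟫ := by
      intro i hi
      simp only [zero_smul, add_zero, hb, real_inner_smul_left, hbb, mul_ite, mul_one, mul_zero]
      rw [Finset.sum_ite_eq J i, if_pos hi, mul_comm]
    simp only [hG]
    rw [Finset.sum_congr rfl h1, ← Finset.sum_sub_distrib]
    simp only [hBρ, hρρ, Finset.mul_sum, ← Finset.sum_sub_distrib]
    simp only [ne_eq, OfNat.ofNat_ne_zero, not_false_eq_true, zero_pow, zero_mul, mul_zero,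
      Finset.sum_const_zero, add_zero]
    refine Finset.sum_congr rfl fun i hi => Finset.sum_congr rfl fun α hα => ?_
    have : β α - β i ≠ 0 := (sub_pos.2 (hgap i hi α (Finset.mem_compl.1 hα))).ne'
    simp only [hr]
    field_simp
  have hD'0 : ∑ i ∈ J, (⟪B' 0 (b i), ρ i⟫ + ⟪B' 0 (ρ i), b i⟫)
      = -2 * ∑ i ∈ J, ∑ α ∈ Jᶜ, ⟪B' 0 (b i), b α⟫ ^ 2 / (β α - β i) := by
    rw [Finset.mul_sum]
    refine Finset.sum_congr rfl fun i hi => ?_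
    rw [hsymm (ρ i), real_inner_comm (B' 0 (b i)), hB'ρ, ← two_mul, Finset.mul_sum, Finset.mul_sum]
    refine Finset.sum_congr rfl fun α hα => ?_
    simp only [hr]
    ring
  rw [hG0, hD'0] at e2
  linarith

theorem hasDerivAt_comp_line {n : ℕ} {F : Type*} [NormedAddCommGroup F] [NormedSpace ℝ F]
    {f : Euc n → F} {f' : Euc n →L[ℝ] F} {q v : Euc n} {t : ℝ}
    (hf : HasFDerivAt f f' (q + t • v)) : HasDerivAt (fun s : ℝ => f (q + s • v)) (f' v) t := by
  have h1 : HasDerivAt (fun s : ℝ => q + s • v) v t := by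
    simpa using ((hasDerivAt_id t).smul_const v).const_add q
  exact hf.comp_hasDerivAt t h1

/-- At a point where `κ_k < κ_{k+1}` there are a principal frame `d`, a drift `y` and a totally
symmetric tensor `C` controlling smooth functions touching `λ_k` from below. -/
theorem IsExpanderPatch.exists_frame_touching {n k : ℕ} {X ν : Euc n → Euc (n + 1)}
    {Ω : Set (Euc n)} {κ : Euc n → Fin n → ℝ} (h : IsExpanderPatch X ν Ω κ)
    (hκmono : ∀ p, Monotone (κ p)) (hκcont : ∀ i, ContinuousOn (fun p => κ p i) Ω)
    (hk1 : k - 1 < n) (hkn : k < n) {q : Euc n} (hq : q ∈ Ω)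
    (hgap : κ q ⟨k - 1, hk1⟩ < κ q ⟨k, hkn⟩) :
    ∃ (d : Fin n → Euc n) (y : Fin n → ℝ) (C : Fin n → Fin n → Fin n → ℝ),
      (∀ a b, ⟪fderiv ℝ X q (d a), fderiv ℝ X q (d b)⟫ = if a = b then (1 : ℝ) else 0) ∧
      (∀ a, y a = ⟪X q - ∑ b, fderiv ℝ (fderiv ℝ X) q (d b) (d b), fderiv ℝ X q (d a)⟫) ∧
      (∀ a i j, C a i j = C a j i) ∧ (∀ a i j, C a i j = C i a j) ∧
      (∀ a, fderiv ℝ (support X ν) q (d a) = ∑ i, C a i i) ∧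
      (∑ a, fderiv ℝ (fderiv ℝ (support X ν)) q (d a) (d a)
        + ∑ a, y a * fderiv ℝ (support X ν) q (d a)
        = -((1 + ∑ a, κ q a ^ 2) * support X ν q)) ∧
      ∀ u : Euc n → ℝ, ContDiff ℝ (⊤ : ℕ∞) u → IsLocalMin (fun p => lamk κ k p - u p) q →
        (∀ a, fderiv ℝ u q (d a) = ∑ i ∈ Finset.univ.filter (fun i : Fin n => i.val < k), C a i i) ∧
        ∑ a, fderiv ℝ (fderiv ℝ u) q (d a) (d a) + ∑ a, y a * fderiv ℝ u q (d a)
          + (1 + ∑ a, κ q a ^ 2) * lamk κ k q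
          + 2 * ∑ a, ∑ i ∈ Finset.univ.filter (fun i : Fin n => i.val < k),
              ∑ s ∈ (Finset.univ.filter (fun i : Fin n => i.val < k))ᶜ,
                C a i s ^ 2 / (κ q s - κ q i) ≤ 0 := by
  set last : Fin n := ⟨n - 1, by omega⟩
  set c : ℝ := κ q last + 1 with hc
  obtain ⟨B, hB⟩ := h.exists_operator c
  obtain ⟨d, hd, hd'⟩ := h.frame q hq
  set J : Finset (Fin n) := Finset.univ.filter (fun i : Fin n => i.val < k) with hJ
  have hmemJ : ∀ i, i ∈ J ↔ i.val < k := fun i => by simp [hJ]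
  refine ⟨d, fun a => ⟪X q - ∑ b, fderiv ℝ (fderiv ℝ X) q (d b) (d b), fderiv ℝ X q (d a)⟫,
    fun a i j => ⟪fderiv ℝ B q (d a) (fderiv ℝ X q (d i)), fderiv ℝ X q (d j)⟫, hd, fun _ => rfl,
    fun a i j => by beta_reduce; rw [h.symm_fderiv hB hq, real_inner_comm],
    fun a i j => by beta_reduce; rw [h.codazzi hB hq], h.trace_fderiv_frame hB hq hd hd',
    h.sum_fderiv_fderiv_support hB hq hd hd', fun u hu hmin => ?_⟩
  obtain ⟨b, hb0, hb⟩ := exists_orthonormalBasis_option hd (h.norm_normal q hq)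
    (fun a => h.inner_normal q hq _)
  have hκc : ∀ i, κ q i < c := fun i => by
    have : κ q i ≤ κ q last := hκmono q (Fin.le_def.2 (by simp only [last]; omega))
    linarith
  have hdir : ∀ a, fderiv ℝ u q (d a)
        = ∑ i ∈ J, ⟪fderiv ℝ B q (d a) (fderiv ℝ X q (d i)), fderiv ℝ X q (d i)⟫ ∧
      fderiv ℝ (fderiv ℝ u) q (d a) (d a)
        ≤ ∑ i ∈ J, ⟪fderiv ℝ (fderiv ℝ B) q (d a) (d a) (fderiv ℝ X q (d i)), fderiv ℝ X q (d i)⟫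
          - 2 * ∑ i ∈ J, (⟪fderiv ℝ B q (d a) (fderiv ℝ X q (d i)), ν q⟫ ^ 2 / (c - κ q i)
            + ∑ s ∈ Jᶜ, ⟪fderiv ℝ B q (d a) (fderiv ℝ X q (d i)), fderiv ℝ X q (d s)⟫ ^ 2
              / (κ q s - κ q i)) := by
    intro a
    have hline : Continuous fun t : ℝ => q + t • d a := by fun_prop
    have hline0 : Filter.Tendsto (fun t : ℝ => q + t • d a) (nhds 0) (nhds q) := by
      simpa using hline.tendsto 0
    have hΩt : ∀ᶠ t in nhds (0 : ℝ), q + t • d a ∈ Ω := hline0.eventually (h.eventually_mem hq)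
    have hκt : ∀ᶠ t in nhds (0 : ℝ), κ (q + t • d a) last < c :=
      hline0.eventually (((hκcont last).continuousAt (h.isOpen.mem_nhds hq)).eventually_lt_const
        (by rw [hc]; linarith))
    have hmapJ : (J.map Function.Embedding.some)ᶜ = Finset.insertNone Jᶜ := by
      ext o
      cases o <;> simp
    have hq0 : q + (0 : ℝ) • d a = q := by simp
    have key := second_order_sum_lowest_eigenvalues (E := Euc (n + 1))
      (B := fun t => B (q + t • d a)) (B' := fun t => fderiv ℝ B (q + t • d a) (d a))
      (B₂ := fderiv ℝ (fderiv ℝ B) q (d a) (d a))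
      (u := fun t => u (q + t • d a)) (u' := fun t => fderiv ℝ u (q + t • d a) (d a))
      (u₂ := fderiv ℝ (fderiv ℝ u) q (d a) (d a)) (c := c)
      (f := fun t => lamk κ k (q + t • d a)) ?_ ?_ ?_ ?_ ?_ ?_ b
      (fun o => o.elim c (κ q)) ?_ (J.map Function.Embedding.some) ?_ ?_ ?_ ?_
    · simp only [hmapJ, Finset.sum_map, Finset.sum_insertNone, Function.Embedding.some_apply, hb,
        hb0, hq0, Option.elim] at key
      exact key
    · refine ContDiffAt.comp (g := B) (f := fun t : ℝ => q + t • d a) 0 ?_ (by fun_prop)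
      rw [hq0]
      exact (hB.contDiffAt q hq).of_le (by norm_cast)
    · filter_upwards [hΩt] with t ht
      exact hasDerivAt_comp_line (hB.hasFDerivAt ht)
    · have := (hB.hasFDerivAt_fderiv hq).clm_apply (hasFDerivAt_const (d a) q)
      rw [← hq0] at this
      simpa using hasDerivAt_comp_line this
    · intro x y
      rw [hq0]
      exact h.symm_fderiv hB hq _ x y
    · exact Filter.Eventually.of_forall fun t => hasDerivAt_comp_line (hu.hasFDerivAt_self _)
    · have := (hu.hasFDerivAt_fderiv q).clm_apply (hasFDerivAt_const (d a) q)
      rw [← hq0] at this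
      simpa using hasDerivAt_comp_line this
    · intro o
      rw [hq0]
      cases o with
      | none => simp [hb0, hB.apply_normal q hq]
      | some i => simp [hb, apply_frame hB hq hd']
    · intro o ho o' ho'
      obtain ⟨i, hi, rfl⟩ := Finset.mem_map.1 ho
      cases o' with
      | none => exact hκc i
      | some s =>
        have hs : ¬ s.val < k := fun hs => ho' (Finset.mem_map.2 ⟨s, (hmemJ s).2 hs, rfl⟩)
        have h1 : κ q i ≤ κ q ⟨k - 1, hk1⟩ :=
          hκmono q (Fin.le_def.2 (by have := (hmemJ i).1 hi; simp only; omega))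
        have h2 : κ q ⟨k, hkn⟩ ≤ κ q s := hκmono q (Fin.le_def.2 (by simp only; omega))
        exact (h1.trans_lt hgap).trans_le h2
    · simp only [hq0, Finset.sum_map]
      rfl
    · filter_upwards [hΩt, hκt] with t ht hct
      obtain ⟨d₁, hd₁, hd₁'⟩ := h.frame _ ht
      obtain ⟨b₁, hb₁0, hb₁⟩ := exists_orthonormalBasis_option hd₁ (h.norm_normal _ ht)
        (fun a => h.inner_normal _ ht _)
      refine ⟨b₁, fun o => o.elim c (κ (q + t • d a)), κ (q + t • d a) ⟨k - 1, hk1⟩, ?_, ?_,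
        ?_, ?_, ?_⟩
      · exact (hκmono _ (Fin.le_def.2 (by simp only [last]; omega))).trans hct.le
      · intro o
        cases o with
        | none => simp [hb₁0, hB.apply_normal _ ht]
        | some i => simp [hb₁, apply_frame hB ht hd₁']
      · intro o ho
        obtain ⟨i, hi, rfl⟩ := Finset.mem_map.1 ho
        exact hκmono _ (Fin.le_def.2 (by have := (hmemJ i).1 hi; simp only; omega))
      · intro o ho
        cases o with
        | none => exact (hκmono _ (Fin.le_def.2 (by simp only [last]; omega))).trans hct.le
        | some s =>
          have hs : ¬ s.val < k := fun hs => ho (Finset.mem_map.2 ⟨s, (hmemJ s).2 hs, rfl⟩)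
          exact hκmono _ (Fin.le_def.2 (by simp only; omega))
      · simp only [Finset.sum_map]
        rfl
    · have h1 : Filter.Tendsto (fun t : ℝ => q + t • d a) (nhds 0) (nhds (q + (0 : ℝ) • d a)) :=
        hline.tendsto 0
      have h2 : IsLocalMin (fun p => lamk κ k p - u p) (q + (0 : ℝ) • d a) := hq0.symm ▸ hmin
      exact h1.eventually h2
  refine ⟨fun a => (hdir a).1, ?_⟩
  have hN : ∀ i ∈ J, ∑ a, ⟪fderiv ℝ B q (d a) (fderiv ℝ X q (d i)), ν q⟫ ^ 2 / (c - κ q i)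
      = -(κ q i * (κ q i ^ 2 - c * κ q i)) := by
    intro i _
    have : ∀ a, ⟪fderiv ℝ B q (d a) (fderiv ℝ X q (d i)), ν q⟫ ^ 2 / (c - κ q i)
        = if i = a then -(κ q a * (κ q a ^ 2 - c * κ q a)) else 0 := by
      intro a
      rw [h.fderiv_inner_normal_frame hB hq hd hd']
      split_ifs with hia
      · subst hia
        have : c - κ q i ≠ 0 := (sub_pos.2 (hκc i)).ne'
        field_simp
        ring
      · simp
    simp only [this]
    simp
  have hS := Finset.sum_congr rfl fun i (_ : i ∈ J) => h.sum_fderiv_fderiv_shape hB hq hd hd' i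
  have h1 := Finset.sum_le_sum fun a (_ : a ∈ Finset.univ) => (hdir a).2
  have h2 : ∀ g : Fin n → Fin n → ℝ, ∑ i ∈ J, ∑ a, g i a = ∑ a, ∑ i ∈ J, g i a :=
    fun g => Finset.sum_comm
  simp only [Finset.sum_sub_distrib, Finset.sum_add_distrib, ← Finset.mul_sum,
    Finset.sum_neg_distrib] at h1 hS
  rw [h2, h2] at hS
  rw [← h2 fun i a => ⟪fderiv ℝ B q (d a) (fderiv ℝ X q (d i)), ν q⟫ ^ 2 / (c - κ q i),
    Finset.sum_congr rfl hN, Finset.sum_neg_distrib] at h1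
  have h3 : ∑ a, ⟪X q - ∑ b, fderiv ℝ (fderiv ℝ X) q (d b) (d b), fderiv ℝ X q (d a)⟫
        * fderiv ℝ u q (d a)
      = ∑ a, ∑ i ∈ J, ⟪X q - ∑ b, fderiv ℝ (fderiv ℝ X) q (d b) (d b), fderiv ℝ X q (d a)⟫
        * ⟪fderiv ℝ B q (d a) (fderiv ℝ X q (d i)), fderiv ℝ X q (d i)⟫ := by
    refine Finset.sum_congr rfl fun a _ => ?_
    rw [(hdir a).1, Finset.mul_sum]
  have h4 : ∑ i ∈ J, 2 * κ q i * (κ q i ^ 2 - c * κ q i)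
      = 2 * ∑ i ∈ J, κ q i * (κ q i ^ 2 - c * κ q i) := by
    rw [Finset.mul_sum]
    exact Finset.sum_congr rfl fun i _ => by ring
  have h5 : lamk κ k q = ∑ i ∈ J, κ q i := rfl
  rw [h3, h5]
  rw [h4] at hS
  linarith

/-- Strong minimum principle for nonnegative functions that are supersolutions, in the viscosity
sense, of a uniformly elliptic inequality. -/
theorem eq_zero_of_viscosity_supersolution {n : ℕ} {v : Euc n → ℝ} {p₀ : Euc n} {R c₁ c₂ : ℝ}
    (hc₁ : 0 < c₁) (hcont : ContinuousOn v (Metric.closedBall p₀ R))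
    (hnonneg : ∀ p ∈ Metric.closedBall p₀ R, 0 ≤ v p) (h0 : v p₀ = 0)
    (hvisc : ∀ q ∈ Metric.ball p₀ R, ∀ w : Euc n → ℝ, ContDiff ℝ (⊤ : ℕ∞) w →
      IsLocalMin (fun p => v p - w p) q → ∃ (d : Fin n → Euc n) (y : Fin n → ℝ),
        (∀ ξ, c₁ * ‖ξ‖ ^ 2 ≤ ∑ a, ⟪d a, ξ⟫ ^ 2) ∧ (∀ a, ‖d a‖ ≤ c₂) ∧ (∀ a, |y a| ≤ c₂) ∧
        ∑ a, fderiv ℝ (fderiv ℝ w) q (d a) (d a) + ∑ a, y a * fderiv ℝ w q (d a) ≤ 0) :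
    ∀ z ∈ Metric.ball p₀ (R / 2), v z = 0 := by
  intro z hz
  by_contra hvz
  have hzR : dist z p₀ < R / 2 := hz
  have hR : 0 < R := by linarith [dist_nonneg (x := z) (y := p₀)]
  set Z : Set (Euc n) := Metric.closedBall p₀ R ∩ v ⁻¹' {0} with hZ
  have hZc : IsCompact Z := (isCompact_closedBall p₀ R).of_isClosed_subset
    (hcont.preimage_isClosed_of_isClosed Metric.isClosed_closedBall isClosed_singleton)
    Set.inter_subset_left
  have hp₀Z : p₀ ∈ Z := ⟨Metric.mem_closedBall_self hR.le, h0⟩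
  obtain ⟨y₀, hy₀, hmin⟩ := hZc.exists_isMinOn ⟨p₀, hp₀Z⟩
    (f := fun p => dist p z) (by fun_prop)
  have hy₀z : dist y₀ z ≤ dist p₀ z := hmin hp₀Z
  have hy₀R : dist y₀ p₀ < R := by
    have := dist_triangle y₀ z p₀
    rw [dist_comm p₀ z] at hy₀z
    linarith
  set ξ : Euc n := y₀ - z with hξ
  have hξ0 : 0 < ‖ξ‖ := by
    rw [norm_pos_iff, hξ, sub_ne_zero]
    rintro rfl
    exact hvz hy₀.2
  obtain ⟨M, hM0, hM⟩ : ∃ M : ℝ, 0 < M ∧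
      n * c₂ ^ 2 * (2 * ‖ξ‖ + 4) < 2 * M * (c₁ * ‖ξ‖ ^ 2) := by
    refine ⟨(n * c₂ ^ 2 * (2 * ‖ξ‖ + 4) + 1) / (c₁ * ‖ξ‖ ^ 2), by positivity, ?_⟩
    have : 0 < c₁ * ‖ξ‖ ^ 2 := by positivity
    rw [mul_assoc 2, div_mul_cancel₀ _ this.ne']
    have : 0 ≤ n * c₂ ^ 2 * (2 * ‖ξ‖ + 4) := by positivity
    linarith
  obtain ⟨ρ, hρ0, hρ1, hρM, hρR⟩ : ∃ ρ : ℝ, 0 < ρ ∧ ρ ≤ 1 ∧ 2 * M * (ρ * ‖ξ‖) ≤ 1 ∧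
      ρ + dist y₀ p₀ < R := by
    have hpos : 0 < 2 * M * ‖ξ‖ := by positivity
    refine ⟨min 1 (min (1 / (2 * M * ‖ξ‖)) ((R - dist y₀ p₀) / 2)), ?_, min_le_left _ _, ?_, ?_⟩
    · have : 0 < (R - dist y₀ p₀) / 2 := by linarith
      positivity
    · have h1 := (min_le_right (1 : ℝ) (min (1 / (2 * M * ‖ξ‖)) ((R - dist y₀ p₀) / 2))).trans
        (min_le_left _ _)
      rw [le_div_iff₀ hpos] at h1
      linarith
    · have h1 := (min_le_right (1 : ℝ) (min (1 / (2 * M * ‖ξ‖)) ((R - dist y₀ p₀) / 2))).trans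
        (min_le_right _ _)
      linarith
  have hsub : Metric.closedBall y₀ ρ ⊆ Metric.ball p₀ R :=
    Metric.closedBall_subset_ball' hρR
  set ℓ : Euc n → ℝ := fun p => ⟪ξ, p - y₀⟫ with hℓ
  set w : Euc n → ℝ := fun p => -ℓ p + M * ℓ p ^ 2 - ⟪p - y₀, p - y₀⟫ with hw
  have hℓbound : ∀ p ∈ Metric.closedBall y₀ ρ, |ℓ p| ≤ ρ * ‖ξ‖ := by
    intro p hp
    have h1 := abs_real_inner_le_norm ξ (p - y₀)
    have h2 : ‖p - y₀‖ ≤ ρ := by rwa [← dist_eq_norm]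
    calc |ℓ p| ≤ ‖ξ‖ * ‖p - y₀‖ := h1
      _ ≤ ‖ξ‖ * ρ := by gcongr
      _ = ρ * ‖ξ‖ := mul_comm _ _
  have hMℓ : ∀ p ∈ Metric.closedBall y₀ ρ, 2 * (M * ℓ p ^ 2) ≤ |ℓ p| := by
    intro p hp
    have h1 : 2 * M * |ℓ p| ≤ 1 :=
      (mul_le_mul_of_nonneg_left (hℓbound p hp) (by positivity)).trans hρM
    rw [← sq_abs]
    nlinarith [abs_nonneg (ℓ p)]
  have hwsmooth : ContDiff ℝ (⊤ : ℕ∞) w := by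
    have h1 : ContDiff ℝ (⊤ : ℕ∞) fun p : Euc n => p - y₀ := by fun_prop
    have h2 : ContDiff ℝ (⊤ : ℕ∞) ℓ := contDiff_const.inner ℝ h1
    exact (h2.neg.add (contDiff_const.mul (h2.pow 2))).sub (h1.inner ℝ h1)
  have hsubD : ∀ p, HasFDerivAt (fun p : Euc n => p - y₀) (ContinuousLinearMap.id ℝ (Euc n)) p :=
    fun p => (hasFDerivAt_id p).sub_const y₀
  have hℓD : ∀ p, HasFDerivAt ℓ (innerSL ℝ ξ) p := fun p =>
    (innerSL ℝ ξ).hasFDerivAt.comp p (hsubD p)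
  have hDw : ∀ p e, fderiv ℝ w p e
      = -⟪ξ, e⟫ + 2 * M * ℓ p * ⟪ξ, e⟫ - 2 * ⟪p - y₀, e⟫ := by
    intro p e
    have h1 : HasFDerivAt w _ p := ((hℓD p).neg.add (((hℓD p).pow 2).const_mul M)).sub ((hsubD p).inner ℝ (hsubD p))
    rw [h1.fderiv]
    simp [fderivInnerCLM_apply, real_inner_comm e]
    ring
  have hD2w : ∀ p e, fderiv ℝ (fderiv ℝ w) p e e = 2 * M * ⟪e, ξ⟫ ^ 2 - 2 * ‖e‖ ^ 2 := by
    intro p e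
    have h1 := (hwsmooth.hasFDerivAt_fderiv p).clm_apply (hasFDerivAt_const e p)
    have h2 := ((hasFDerivAt_const (-⟪ξ, e⟫ : ℝ) p).add
      (((hℓD p).const_mul (2 * M)).mul_const ⟪ξ, e⟫)).sub
      (((hsubD p).inner ℝ (hasFDerivAt_const e p)).const_mul 2)
    have h3 := h1.eq_of_eventuallyEq h2 (Filter.Eventually.of_forall fun q => hDw q e) e
    simp [fderivInnerCLM_apply] at h3
    rw [h3, real_inner_comm]
    ring
  obtain ⟨δ, hδ0, hδ⟩ := ((isCompact_sphere y₀ ρ).inter_right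
      (isClosed_le continuous_const hwsmooth.continuous : IsClosed {p | 0 ≤ w p})).exists_forall_le'
    (f := v) (a := 0) (hcont.mono fun p hp => Metric.ball_subset_closedBall
      (hsub (Metric.sphere_subset_closedBall hp.1))) (by
      rintro p ⟨hpS, hpw⟩
      have hpB := Metric.sphere_subset_closedBall hpS
      have hpR := Metric.ball_subset_closedBall (hsub hpB)
      refine (hnonneg p hpR).lt_of_ne fun hv0 => ?_
      have h1 : dist y₀ z ≤ dist p z := hmin (show p ∈ Z from ⟨hpR, hv0.symm⟩)
      have h2 : ‖ξ‖ ^ 2 ≤ ‖ξ + (p - y₀)‖ ^ 2 := by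
        gcongr
        rw [dist_eq_norm, dist_eq_norm] at h1
        have h3 : ξ + (p - y₀) = p - z := by rw [hξ]; abel
        rwa [h3]
      rw [norm_add_sq_real] at h2
      have h3 : ‖p - y₀‖ = ρ := by rw [← dist_eq_norm]; exact hpS
      have h4 := hMℓ p hpB
      have h5 : w p = -ℓ p + M * ℓ p ^ 2 - ρ ^ 2 := by
        simp only [hw, real_inner_self_eq_norm_sq, h3]
      have h6 : 0 ≤ w p := hpw
      have h7 : 0 ≤ 2 * ℓ p + ρ ^ 2 := by
        rw [h3] at h2
        linarith
      have h8 : 0 < ρ ^ 2 := by positivity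
      rcases abs_cases (ℓ p) with ⟨h9, _⟩ | ⟨h9, _⟩ <;> rw [h9] at h4 <;> linarith)
  set ε : ℝ := δ / (2 * (ρ * ‖ξ‖)) with hε
  have hε0 : 0 < ε := by positivity
  obtain ⟨q, hq, hqmin⟩ := (isCompact_closedBall y₀ ρ).exists_isLocalMin_mem_open
    (f := fun p => v p - ε * w p) (z := y₀) Metric.ball_subset_closedBall
    ((hcont.mono (hsub.trans Metric.ball_subset_closedBall)).sub
      (continuousOn_const.mul hwsmooth.continuous.continuousOn)) (Metric.mem_closedBall_self hρ0.le) (by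
      rintro p ⟨hpB, hpS⟩
      have hpS : p ∈ Metric.sphere y₀ ρ :=
        le_antisymm hpB (not_lt.1 hpS)
      have hvy : v y₀ - ε * w y₀ = 0 := by
        have : v y₀ = 0 := hy₀.2
        simp [hw, hℓ, this]
      rw [hvy]
      by_cases hpw : 0 ≤ w p
      · have h1 := hδ p ⟨hpS, hpw⟩
        have h2 : w p ≤ 3 / 2 * (ρ * ‖ξ‖) := by
          have h3 := hMℓ p hpB
          have h4 := hℓbound p hpB
          have h5 : 0 ≤ ⟪p - y₀, p - y₀⟫ := real_inner_self_nonneg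
          have h6 := neg_abs_le (ℓ p)
          simp only [hw]
          linarith
        have h3 : ε * w p ≤ 3 / 4 * δ := by
          refine (mul_le_mul_of_nonneg_left h2 hε0.le).trans_eq ?_
          rw [hε]
          field_simp
          norm_num
        linarith
      · have h1 := hnonneg p (Metric.ball_subset_closedBall (hsub hpB))
        nlinarith [not_le.1 hpw]) Metric.isOpen_ball
  have hqB := Metric.ball_subset_closedBall hq
  obtain ⟨d, y, hd, hdc, hyc, hle⟩ := hvisc q (hsub hqB) (fun p => ε * w p)
    (contDiff_const.mul hwsmooth) hqmin
  have hc₂ : ∀ a : Fin n, 0 ≤ c₂ := fun a => (norm_nonneg _).trans (hdc a)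
  have hDε : ∀ p, fderiv ℝ (fun p => ε * w p) p = ε • fderiv ℝ w p := fun p =>
    fderiv_const_mul ((hwsmooth.differentiable (by simp)) p) ε
  have hD2ε : fderiv ℝ (fderiv ℝ (fun p => ε * w p)) q = ε • fderiv ℝ (fderiv ℝ w) q := by
    rw [funext hDε]
    exact fderiv_const_smul (hwsmooth.hasFDerivAt_fderiv q).differentiableAt ε
  simp only [hDε, hD2ε, smul_apply, smul_eq_mul, ← mul_assoc,
    mul_comm _ ε] at hle
  simp only [mul_assoc, ← Finset.mul_sum, ← mul_add] at hle
  replace hle := nonpos_of_mul_nonpos_right hle hε0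
  have hsecond : 2 * M * (c₁ * ‖ξ‖ ^ 2) - n * (2 * c₂ ^ 2)
      ≤ ∑ a, fderiv ℝ (fderiv ℝ w) q (d a) (d a) := by
    have h1 : ∑ a : Fin n, 2 * ‖d a‖ ^ 2 ≤ n * (2 * c₂ ^ 2) := by
      refine (Finset.sum_le_card_nsmul _ _ (2 * c₂ ^ 2) fun a _ => ?_).trans_eq (by simp)
      have := hdc a
      gcongr
    simp only [hD2w, Finset.sum_sub_distrib, ← Finset.mul_sum] at h1 ⊢
    have := mul_le_mul_of_nonneg_left (hd ξ) (by positivity : 0 ≤ 2 * M)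
    linarith
  have hfirst : -(n * (c₂ ^ 2 * (2 * ‖ξ‖ + 2))) ≤ ∑ a, y a * fderiv ℝ w q (d a) := by
    have h1 : ∀ a, |y a * fderiv ℝ w q (d a)| ≤ c₂ ^ 2 * (2 * ‖ξ‖ + 2) := by
      intro a
      have h2 : |⟪ξ, d a⟫| ≤ ‖ξ‖ * c₂ :=
        (abs_real_inner_le_norm _ _).trans (by have := hdc a; gcongr)
      have h3 : |⟪q - y₀, d a⟫| ≤ c₂ := by
        refine (abs_real_inner_le_norm _ _).trans ?_
        have h4 : ‖q - y₀‖ ≤ 1 := by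
          rw [← dist_eq_norm]
          exact le_trans hqB hρ1
        nlinarith [hdc a, norm_nonneg (d a)]
      have h4 : |2 * M * ℓ q| ≤ 1 := by
        rw [abs_mul, abs_of_pos (by positivity : 0 < 2 * M)]
        exact (mul_le_mul_of_nonneg_left (hℓbound q hqB) (by positivity)).trans hρM
      have h5 : |2 * M * ℓ q * ⟪ξ, d a⟫| ≤ ‖ξ‖ * c₂ := by
        rw [abs_mul]
        nlinarith [abs_nonneg ⟪ξ, d a⟫]
      have h6 : |fderiv ℝ w q (d a)| ≤ c₂ * (2 * ‖ξ‖ + 2) := by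
        rw [hDw]
        rw [abs_le] at *
        constructor <;> linarith
      rw [abs_mul]
      calc |y a| * |fderiv ℝ w q (d a)| ≤ c₂ * (c₂ * (2 * ‖ξ‖ + 2)) :=
            mul_le_mul (hyc a) h6 (abs_nonneg _) (hc₂ a)
        _ = _ := by ring
    have h2 : |∑ a, y a * fderiv ℝ w q (d a)| ≤ n * (c₂ ^ 2 * (2 * ‖ξ‖ + 2)) := by
      refine (Finset.abs_sum_le_sum_abs _ _).trans
        ((Finset.sum_le_card_nsmul _ _ _ fun a _ => h1 a).trans_eq (by simp))
    exact (abs_le.1 h2).1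
  nlinarith

/-- Vectors with orthonormal images under a linear map form a basis. -/
theorem eq_sum_inner_smul_of_orthonormal_image {n : ℕ} {F : Type*} [NormedAddCommGroup F]
    [InnerProductSpace ℝ F] (T : Euc n →L[ℝ] F) {d : Fin n → Euc n}
    (hd : ∀ a b, ⟪T (d a), T (d b)⟫ = if a = b then (1 : ℝ) else 0) (u : Euc n) :
    u = ∑ a, ⟪T (d a), T u⟫ • d a := by
  have hon : Orthonormal ℝ (T ∘ d) := orthonormal_iff_ite.2 hd
  have hli : LinearIndependent ℝ d :=
    LinearIndependent.of_comp (T : Euc n →ₗ[ℝ] F) hon.linearIndependent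
  have hspan := hli.span_eq_top_of_card_eq_finrank' (by simp)
  obtain ⟨c, rfl⟩ := (Submodule.mem_span_range_iff_exists_fun ℝ).1
    (hspan ▸ Submodule.mem_top : u ∈ Submodule.span ℝ (Set.range d))
  refine Finset.sum_congr rfl fun a _ => ?_
  simp [map_sum, inner_sum, real_inner_smul_right, hd]

/-- Frames with orthonormal images are uniformly bounded and nondegenerate near a point. -/
theorem IsExpanderPatch.exists_uniform_bounds {n : ℕ} {X ν : Euc n → Euc (n + 1)}
    {Ω : Set (Euc n)} {κ : Euc n → Fin n → ℝ} (h : IsExpanderPatch X ν Ω κ) {K : Set (Euc n)}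
    (hK : IsCompact K) (hKΩ : K ⊆ Ω) : ∃ c₁ c₂ : ℝ, 0 < c₁ ∧ ∀ q ∈ K, ∀ d : Fin n → Euc n,
      (∀ a b, ⟪fderiv ℝ X q (d a), fderiv ℝ X q (d b)⟫ = if a = b then (1 : ℝ) else 0) →
      (∀ ξ, c₁ * ‖ξ‖ ^ 2 ≤ ∑ a, ⟪d a, ξ⟫ ^ 2) ∧ (∀ a, ‖d a‖ ≤ c₂) ∧
      ∀ a, |⟪X q - ∑ b, fderiv ℝ (fderiv ℝ X) q (d b) (d b), fderiv ℝ X q (d a)⟫| ≤ c₂ := by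
  have hX0 : Continuous X := h.contDiff.continuous
  have hX1 : Continuous (fderiv ℝ X) := h.contDiff.continuous_fderiv (by simp)
  have hX2 : Continuous (fderiv ℝ (fderiv ℝ X)) :=
    (h.contDiff.fderiv_right (m := 1) (by norm_cast)).continuous_fderiv (by simp)
  obtain ⟨C₀, hC₀⟩ := hK.exists_bound_of_continuousOn hX0.continuousOn
  obtain ⟨C₁, hC₁⟩ := hK.exists_bound_of_continuousOn hX1.continuousOn
  obtain ⟨C₂, hC₂⟩ := hK.exists_bound_of_continuousOn
    (E := Euc n →L[ℝ] Euc n →L[ℝ] Euc (n + 1)) hX2.continuousOn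
  obtain ⟨m, hm0, hm⟩ := (hK.prod (isCompact_sphere (0 : Euc n) 1)).exists_forall_le'
    (f := fun z : Euc n × Euc n => ‖fderiv ℝ X z.1 z.2‖) (a := 0)
    (((hX1.comp continuous_fst).clm_apply continuous_snd).norm.continuousOn) (by
      rintro ⟨q, u⟩ ⟨hq, hu⟩
      obtain ⟨d, hd, -⟩ := h.frame q (hKΩ hq)
      refine norm_pos_iff.2 fun h0 => ?_
      have h1 := eq_sum_inner_smul_of_orthonormal_image _ hd u
      simp only at h0
      simp only [h0, inner_zero_right, zero_smul, Finset.sum_const_zero] at h1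
      subst h1
      simp at hu)
  have hlow : ∀ q ∈ K, ∀ u, m * ‖u‖ ≤ ‖fderiv ℝ X q u‖ := by
    intro q hq u
    rcases eq_or_ne u 0 with rfl | hu
    · simp
    have hu' : 0 < ‖u‖ := norm_pos_iff.2 hu
    have h1 := hm (q, ‖u‖⁻¹ • u) ⟨hq, by simp [norm_smul, hu'.ne']⟩
    simp only [map_smul, norm_smul, norm_inv, norm_norm] at h1
    rwa [inv_mul_eq_div, le_div_iff₀ hu'] at h1
  refine ⟨1 / (|C₁| + 1) ^ 2, |C₀| + n * (|C₂| * (1 / m) ^ 2) + 1 / m, by positivity,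
    fun q hq d hd => ?_⟩
  have hon : Orthonormal ℝ (fun a => fderiv ℝ X q (d a)) := orthonormal_iff_ite.2 hd
  have hdm : ∀ a, ‖d a‖ ≤ 1 / m := by
    intro a
    have h1 := hlow q hq (d a)
    rw [hon.norm_eq_one a] at h1
    rw [le_div_iff₀ hm0]
    linarith
  have hupper : ∀ u, ‖fderiv ℝ X q u‖ ≤ (|C₁| + 1) * ‖u‖ := fun u =>
    (ContinuousLinearMap.le_opNorm _ _).trans (by
      have := (hC₁ q hq).trans (le_abs_self C₁)
      gcongr
      linarith)
  refine ⟨fun ξ => ?_, fun a => (hdm a).trans ?_, fun a => ?_⟩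
  · have h1 := eq_sum_inner_smul_of_orthonormal_image _ hd ξ
    have h2 : ‖ξ‖ ^ 2 = ∑ a, ⟪fderiv ℝ X q (d a), fderiv ℝ X q ξ⟫ * ⟪d a, ξ⟫ := by
      rw [← real_inner_self_eq_norm_sq]
      conv_lhs => rw [h1, sum_inner, ← h1]
      simp only [real_inner_smul_left]
    have h3 := Finset.sum_mul_sq_le_sq_mul_sq Finset.univ
      (fun a => ⟪fderiv ℝ X q (d a), fderiv ℝ X q ξ⟫) (fun a => ⟪d a, ξ⟫)
    rw [← h2] at h3
    have h4 : ∑ a, ⟪fderiv ℝ X q (d a), fderiv ℝ X q ξ⟫ ^ 2 ≤ ‖fderiv ℝ X q ξ‖ ^ 2 := by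
      simpa using hon.sum_inner_products_le (fderiv ℝ X q ξ) (s := Finset.univ)
    have h5 : ‖fderiv ℝ X q ξ‖ ^ 2 ≤ (|C₁| + 1) ^ 2 * ‖ξ‖ ^ 2 := by
      rw [← mul_pow]
      gcongr
      exact hupper ξ
    have h6 : 0 ≤ ∑ a, ⟪d a, ξ⟫ ^ 2 := Finset.sum_nonneg fun a _ => sq_nonneg _
    rw [one_div_mul_eq_div, div_le_iff₀ (by positivity)]
    rcases eq_or_ne ξ 0 with rfl | hξ
    · simp
    have h7 : 0 < ‖ξ‖ ^ 2 := by positivity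
    refine le_of_mul_le_mul_right ?_ h7
    calc ‖ξ‖ ^ 2 * ‖ξ‖ ^ 2 = (‖ξ‖ ^ 2) ^ 2 := by ring
      _ ≤ _ := h3
      _ ≤ ((|C₁| + 1) ^ 2 * ‖ξ‖ ^ 2) * ∑ a, ⟪d a, ξ⟫ ^ 2 :=
        mul_le_mul_of_nonneg_right (h4.trans h5) h6
      _ = _ := by ring
  · have : 0 ≤ |C₀| + n * (|C₂| * (1 / m) ^ 2) := by positivity
    linarith
  · refine (abs_real_inner_le_norm _ _).trans ?_
    rw [hon.norm_eq_one a, mul_one]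
    have h1 : ∀ b, ‖fderiv ℝ (fderiv ℝ X) q (d b) (d b)‖ ≤ |C₂| * (1 / m) ^ 2 := by
      intro b
      refine (ContinuousLinearMap.le_opNorm₂ _ _ _).trans ?_
      have h2 := (hC₂ q hq).trans (le_abs_self C₂)
      have h3 := hdm b
      rw [mul_assoc, sq]
      gcongr
    have h2 : ‖∑ b, fderiv ℝ (fderiv ℝ X) q (d b) (d b)‖ ≤ n * (|C₂| * (1 / m) ^ 2) :=
      (norm_sum_le _ _).trans
        ((Finset.sum_le_card_nsmul _ _ _ fun b _ => h1 b).trans_eq (by simp))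
    have h3 := (hC₀ q hq).trans (le_abs_self C₀)
    have h4 := norm_sub_le (X q) (∑ b, fderiv ℝ (fderiv ℝ X) q (d b) (d b))
    have h5 : 0 < 1 / m := by positivity
    linarith

theorem neg_of_phiSX_neg {t : ℝ} (h : phiSX t < 0) : t < 0 := by
  by_contra ht
  simp [phiSX, ht] at h

theorem le_of_phiSX_le {s t : ℝ} (hs : s < 0) (h : phiSX s ≤ phiSX t) : s ≤ t := by
  by_contra! hts
  have ht : t < 0 := hts.trans hs
  simp only [phiSX, if_pos hs, if_pos ht] at h
  have h2 : s ^ 2 < t ^ 2 := by nlinarith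
  have hs2 : 0 < s ^ 2 := sq_pos_of_neg hs
  have h4 : s ^ 4 < t ^ 4 := by nlinarith
  have hexp : Real.exp (-1 / s ^ 2) ≤ Real.exp (-1 / t ^ 2) := by
    rw [Real.exp_le_exp, neg_div, neg_div, neg_le_neg_iff]
    gcongr
  have := mul_lt_mul h4 hexp (Real.exp_pos _) (by positivity)
  linarith

theorem IsExpanderPatch.false_of_lamk_ge {n k : ℕ} {X ν : Euc n → Euc (n + 1)}
    {Ω : Set (Euc n)} {κ : Euc n → Fin n → ℝ} (h : IsExpanderPatch X ν Ω κ)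
    (hκmono : ∀ p, Monotone (κ p)) (hκcont : ∀ i, ContinuousOn (fun p => κ p i) Ω)
    (hk1 : k - 1 < n) (hkn : k < n) {p₀ : Euc n} (hp₀ : p₀ ∈ Ω)
    (hgap : κ p₀ ⟨k - 1, hk1⟩ < κ p₀ ⟨k, hkn⟩) {ε₀ : ℝ} (hε₀ : ε₀ < 0)
    (hpos : 0 < support X ν p₀) (heq : lamk κ k p₀ = ε₀ * support X ν p₀)
    (hge : ∀ p ∈ Ω, κ p ⟨k - 1, hk1⟩ < κ p ⟨k, hkn⟩ →
      ε₀ * support X ν p ≤ lamk κ k p) : False := by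
  set J : Finset (Fin n) := Finset.univ.filter (fun i : Fin n => i.val < k) with hJ
  have hmemJ : ∀ i, i ∈ J ↔ i.val < k := fun i => by simp [hJ]
  have hsup := h.contDiff_support
  have hκat : ∀ i, ∀ q ∈ Ω, ContinuousAt (fun p => κ p i) q := fun i q hq =>
    (hκcont i).continuousAt (h.isOpen.mem_nhds hq)
  have hlamcont : ContinuousOn (lamk κ k) Ω := continuousOn_finsetSum _ fun i _ => hκcont i
  obtain ⟨R, hR0, hR⟩ : ∃ R > 0, ∀ p ∈ Metric.closedBall p₀ R,
      p ∈ Ω ∧ κ p ⟨k - 1, hk1⟩ < κ p ⟨k, hkn⟩ := by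
    obtain ⟨R, hR0, hR⟩ := Metric.nhds_basis_closedBall.mem_iff.1
      ((h.eventually_mem hp₀).and ((hκat _ _ hp₀).eventually_lt (hκat _ _ hp₀) hgap))
    exact ⟨R, hR0, fun p hp => hR hp⟩
  have hquot : ∀ q ∈ Metric.closedBall p₀ R, ∀ i ∈ J, ∀ s ∈ Jᶜ, 0 < κ q s - κ q i := by
    intro q hq i hi s hs
    have hi := (hmemJ i).1 hi
    have hs : ¬ s.val < k := fun hs' => Finset.mem_compl.1 hs ((hmemJ s).2 hs')
    have h1 : κ q i ≤ κ q ⟨k - 1, hk1⟩ := hκmono q (Fin.le_def.2 (by simp only; omega))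
    have h2 : κ q ⟨k, hkn⟩ ≤ κ q s := hκmono q (Fin.le_def.2 (by simp only; omega))
    have := (hR q hq).2
    linarith
  have hQ : ∀ q ∈ Metric.closedBall p₀ R, ∀ C : Fin n → Fin n → Fin n → ℝ, ∀ a, ∀ i ∈ J,
      ∀ s ∈ Jᶜ, 0 ≤ C a i s ^ 2 / (κ q s - κ q i) := fun q hq C a i hi s hs =>
    div_nonneg (sq_nonneg _) (hquot q hq i hi s hs).le
  obtain ⟨c₁, c₂, hc₁, hbd⟩ := h.exists_uniform_bounds (isCompact_closedBall p₀ R)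
    fun p hp => (hR p hp).1
  have hzero : ∀ z ∈ Metric.ball p₀ (R / 2), lamk κ k z - ε₀ * support X ν z = 0 := by
    refine eq_zero_of_viscosity_supersolution hc₁ (c₂ := c₂)
      ((hlamcont.mono fun p hp => (hR p hp).1).sub
        (continuousOn_const.mul hsup.continuous.continuousOn))
      (fun p hp => sub_nonneg.2 (hge p (hR p hp).1 (hR p hp).2)) (by rw [heq, sub_self]) ?_
    intro q hq w hw hmin
    have hqB := Metric.ball_subset_closedBall hq
    obtain ⟨d, y, C, hd, hy, -, -, -, hH, htouch⟩ := h.exists_frame_touching hκmono hκcont hk1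
      hkn (hR q hqB).1 (hR q hqB).2
    obtain ⟨hb1, hb2, hb3⟩ := hbd q hqB d hd
    refine ⟨d, y, hb1, hb2, fun a => by rw [hy]; exact hb3 a, ?_⟩
    obtain ⟨-, h1⟩ := htouch (fun p => ε₀ * support X ν p + w p)
      ((contDiff_const.mul hsup).add hw) (by simpa only [sub_add_eq_sub_sub] using hmin)
    have hD : ∀ p, fderiv ℝ (fun p => ε₀ * support X ν p + w p) p
        = ε₀ • fderiv ℝ (support X ν) p + fderiv ℝ w p := fun p =>
      (((hsup.hasFDerivAt_self p).const_mul ε₀).add (hw.hasFDerivAt_self p)).fderiv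
    have hD2 : fderiv ℝ (fderiv ℝ (fun p => ε₀ * support X ν p + w p)) q
        = ε₀ • fderiv ℝ (fderiv ℝ (support X ν)) q + fderiv ℝ (fderiv ℝ w) q := by
      rw [funext hD]
      exact (((hsup.hasFDerivAt_fderiv q).const_smul ε₀).add (hw.hasFDerivAt_fderiv q)).fderiv
    simp only [hD, hD2, add_apply, smul_apply, smul_eq_mul, mul_add, Finset.sum_add_distrib,
      mul_left_comm _ ε₀, ← Finset.mul_sum] at h1
    have h2 : 0 ≤ ∑ a, ∑ i ∈ J, ∑ s ∈ Jᶜ, C a i s ^ 2 / (κ q s - κ q i) :=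
      Finset.sum_nonneg fun a _ => Finset.sum_nonneg fun i hi => Finset.sum_nonneg fun s hs =>
        hQ q hqB C a i hi s hs
    have h3 := hge q (hR q hqB).1 (hR q hqB).2
    have h4 : 0 ≤ ∑ a, κ q a ^ 2 := Finset.sum_nonneg fun a _ => sq_nonneg _
    have h5 := mul_nonneg (add_nonneg zero_le_one h4) (sub_nonneg.2 h3)
    have h6 := congrArg (fun x => ε₀ * x) hH
    linarith
  have hgrad : ∀ q ∈ Metric.ball p₀ (R / 2), fderiv ℝ (support X ν) q = 0 := by
    intro q hq
    have hqB : q ∈ Metric.closedBall p₀ R :=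
      Metric.ball_subset_closedBall (Metric.ball_subset_ball (by linarith) hq)
    obtain ⟨d, y, C, hd, hy, hC1, hC2, hDH, hH, htouch⟩ := h.exists_frame_touching hκmono hκcont
      hk1 hkn (hR q hqB).1 (hR q hqB).2
    have hmin : IsLocalMin (fun p => lamk κ k p - ε₀ * support X ν p) q := by
      filter_upwards [Metric.isOpen_ball.mem_nhds hq] with p hp
      rw [hzero p hp, hzero q hq]
    obtain ⟨h0, h1⟩ := htouch (fun p => ε₀ * support X ν p) (contDiff_const.mul hsup) hmin
    have hD : ∀ p, fderiv ℝ (fun p => ε₀ * support X ν p) p = ε₀ • fderiv ℝ (support X ν) p :=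
      fun p => ((hsup.hasFDerivAt_self p).const_mul ε₀).fderiv
    have hD2 : fderiv ℝ (fderiv ℝ (fun p => ε₀ * support X ν p)) q
        = ε₀ • fderiv ℝ (fderiv ℝ (support X ν)) q := by
      rw [funext hD]
      exact ((hsup.hasFDerivAt_fderiv q).const_smul ε₀).fderiv
    simp only [hD, hD2, smul_apply, smul_eq_mul, mul_left_comm _ ε₀, ← Finset.mul_sum] at h1 h0
    have h2 : ∑ a, ∑ i ∈ J, ∑ s ∈ Jᶜ, C a i s ^ 2 / (κ q s - κ q i) ≤ 0 := by
      have h6 := congrArg (fun x => ε₀ * x) hH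
      have h7 : lamk κ k q = ε₀ * support X ν q := sub_eq_zero.1 (hzero q hq)
      rw [h7] at h1
      linarith
    have hCz : ∀ a, ∀ i ∈ J, ∀ s ∈ Jᶜ, C a i s = 0 := by
      intro a i hi s hs
      have h3 : C a i s ^ 2 / (κ q s - κ q i) ≤ 0 := by
        refine le_trans ?_ h2
        refine le_trans ?_ (Finset.single_le_sum (f := fun a => ∑ i ∈ J, ∑ s ∈ Jᶜ,
          C a i s ^ 2 / (κ q s - κ q i)) (fun a _ => Finset.sum_nonneg fun i hi =>
            Finset.sum_nonneg fun s hs => hQ q hqB C a i hi s hs) (Finset.mem_univ a))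
        refine le_trans ?_ (Finset.single_le_sum (f := fun i => ∑ s ∈ Jᶜ,
          C a i s ^ 2 / (κ q s - κ q i)) (fun i hi =>
            Finset.sum_nonneg fun s hs => hQ q hqB C a i hi s hs) hi)
        exact Finset.single_le_sum (f := fun s => C a i s ^ 2 / (κ q s - κ q i))
          (fun s hs => hQ q hqB C a i hi s hs) hs
      rw [div_le_iff₀ (hquot q hqB i hi s hs), zero_mul] at h3
      exact pow_eq_zero_iff two_ne_zero |>.1 (le_antisymm h3 (sq_nonneg _))
    have hDd : ∀ a, fderiv ℝ (support X ν) q (d a) = 0 := by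
      intro a
      by_cases ha : a ∈ J
      · have h3 : ∑ i, C a i i = ∑ i ∈ J, C a i i := by
          rw [← Finset.sum_add_sum_compl J, Finset.sum_eq_zero (s := Jᶜ), add_zero]
          intro s hs
          rw [hC2]
          exact hCz s a ha s hs
        have h4 := hDH a
        rw [h3, ← h0 a] at h4
        nlinarith
      · have h3 : ∑ i ∈ J, C a i i = 0 := Finset.sum_eq_zero fun i hi => by
          rw [hC2, hC1]
          exact hCz i i hi a (Finset.mem_compl.2 ha)
        have h4 := h0 a
        rw [h3] at h4
        exact (mul_eq_zero.1 h4).resolve_left hε₀.ne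
    ext u
    rw [eq_sum_inner_smul_of_orthonormal_image _ hd u]
    simp [map_sum, hDd]
  have hp₀b : p₀ ∈ Metric.ball p₀ (R / 2) := Metric.mem_ball_self (by linarith)
  obtain ⟨d, y, C, -, -, -, -, -, hH, -⟩ := h.exists_frame_touching hκmono hκcont hk1 hkn hp₀ hgap
  have hD2 : fderiv ℝ (fderiv ℝ (support X ν)) p₀ = 0 := by
    have : fderiv ℝ (support X ν) =ᶠ[nhds p₀] fun _ => 0 :=
      Filter.eventually_of_mem (Metric.isOpen_ball.mem_nhds hp₀b) hgrad
    rw [this.fderiv_eq]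
    simp
  simp only [hD2, hgrad p₀ hp₀b, zero_apply, mul_zero, Finset.sum_const_zero, add_zero] at hH
  have h4 : 0 ≤ ∑ a, κ p₀ a ^ 2 := Finset.sum_nonneg fun a _ => sq_nonneg _
  nlinarith

/-- Lemma 3.5 of the paper.
Let Σⁿ be a complete immersed two-sided mean convex self-expander (here a smooth immersed
patch `X` on the open domain `Ω` with unit normal `ν`, satisfying H = ⟨x, ν⟩ and H > 0),
with ordered principal curvatures κ₁ ≤ ⋯ ≤ κₙ (eigenvalues of the shape operator g⁻¹h).
Fix 1 ≤ k < n and set Σᵏ = {p : κ_k(p) < κ_{k+1}(p)} (0-indexed: κ p ⟨k-1⟩ < κ p ⟨k⟩).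
Then φ(λ_k/H) cannot attain a negative infimum at an interior point of Σᵏ. -/
theorem stmt_13 {n k : ℕ} (hk1 : 1 ≤ k) (hkn : k < n)
    (X ν : Euc n → Euc (n + 1)) (Ω : Set (Euc n)) (hΩ : IsOpen Ω)
    (hX : ContDiff ℝ (⊤ : ℕ∞) X) (hν : ContDiff ℝ (⊤ : ℕ∞) ν)
    (himm : ∀ p ∈ Ω, IsUnit (gMat X p).det)
    (hunit : ∀ p ∈ Ω, ‖ν p‖ = 1)
    (horth : ∀ p ∈ Ω, ∀ i, ⟪ν p, pdV X i p⟫ = (0 : ℝ))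
    (hexp : ∀ p ∈ Ω, meanCurv X ν p = ⟪X p, ν p⟫)
    (hmc : ∀ p ∈ Ω, 0 < meanCurv X ν p)
    (κ : Euc n → Fin n → ℝ) (hκmono : ∀ p, Monotone (κ p))
    (hκeig : ∀ p ∈ Ω,
      (gInv X p * Matrix.of (fun i j => sff X ν i j p)).charpoly
        = ∏ i, (Polynomial.X - Polynomial.C (κ p i)))
    (hκcont : ∀ i, ContinuousOn (fun p => κ p i) Ω) :
    ¬ ∃ p₀ ∈ {p ∈ Ω | κ p ⟨k - 1, by omega⟩ < κ p ⟨k, hkn⟩},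
        phiSX (ratk X ν κ k p₀) < 0 ∧
          ∀ p ∈ {p ∈ Ω | κ p ⟨k - 1, by omega⟩ < κ p ⟨k, hkn⟩},
            phiSX (ratk X ν κ k p₀) ≤ phiSX (ratk X ν κ k p) := by
  have h := isExpanderPatch hΩ hX hν himm hunit horth hexp hκmono hκeig
  rintro ⟨p₀, ⟨hp₀, hgap⟩, hneg, hinf⟩
  have hε₀ := neg_of_phiSX_neg hneg
  refine h.false_of_lamk_ge hκmono hκcont (by omega) hkn hp₀ hgap hε₀ ?_ ?_ fun p hp hpgap => ?_
  · exact (hmc p₀ hp₀).trans_eq (hexp p₀ hp₀)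
  · change _ = _ * ⟪X p₀, ν p₀⟫
    rw [← hexp p₀ hp₀, ratk, div_mul_cancel₀ _ (hmc p₀ hp₀).ne']
  · have h1 := le_of_phiSX_le hε₀ (hinf p ⟨hp, hpgap⟩)
    change _ * ⟪X p, ν p⟫ ≤ _
    rw [← hexp p hp]
    exact (le_div_iff₀ (hmc p hp)).1 h1

end
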